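/- arXiv:1202.6022 — 11 statements merged into one kernel-verified Lean document; each statement's English description precedes it below -/
import Mathlib

section
/- For every natural number a ≥ 1, if α is a root of f_a = x³ − a·x² − (a+3)·x − 1 (a cyclic cubic polynomial), then α′ = −(α+1)/α and α″ = −1/(α+1) are also roots of f_a, so that f_a = (x − α)(x − α′)(x − α″). -/
/-- For every natural number `a ≥ 1`, if `α` is a root of
`f_a = x³ − a·x² − (a+3)·x − 1` (in a field of characteristic zero, e.g. `ℝ` or a
splitting field), then `α′ = −(α+1)/α` and `α″ = −1/(α+1)` are also roots of `f_a`,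
and `f_a = (x − α)(x − α′)(x − α″)`. -/
theorem stmt_0 (a : ℕ) (ha : 1 ≤ a) (K : Type*) [Field K] [CharZero K]
    (α : K) (hα : α ^ 3 - (a : K) * α ^ 2 - ((a : K) + 3) * α - 1 = 0) :
    ((-(α + 1) / α) ^ 3 - (a : K) * (-(α + 1) / α) ^ 2
        - ((a : K) + 3) * (-(α + 1) / α) - 1 = 0) ∧
    ((-1 / (α + 1)) ^ 3 - (a : K) * (-1 / (α + 1)) ^ 2
        - ((a : K) + 3) * (-1 / (α + 1)) - 1 = 0) ∧
    (∀ x : K, x ^ 3 - (a : K) * x ^ 2 - ((a : K) + 3) * x - 1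
        = (x - α) * (x - (-(α + 1) / α)) * (x - (-1 / (α + 1)))) := by
  have h0 : α ≠ 0 := by
    rintro rfl
    simp at hα
  have h1 : α + 1 ≠ 0 := by
    intro h
    have h2 : α = -1 := eq_neg_of_add_eq_zero_left h
    subst h2
    have : (1 : K) = 0 := by linear_combination hα
    exact one_ne_zero this
  have key : ∀ x : K, x ^ 3 - (a : K) * x ^ 2 - ((a : K) + 3) * x - 1
        = (x - α) * (x - (-(α + 1) / α)) * (x - (-1 / (α + 1))) := by
    intro x
    obtain ⟨b, hb⟩ : ∃ b, b = -(α + 1) / α := ⟨_, rfl⟩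
    obtain ⟨c, hc⟩ : ∃ c, c = -1 / (α + 1) := ⟨_, rfl⟩
    rw [← hb, ← hc]
    rw [eq_div_iff h0] at hb
    rw [eq_div_iff h1] at hc
    have h2 : α * (α + 1) ≠ 0 := mul_ne_zero h0 h1
    apply mul_left_cancel₀ h2
    linear_combination (x ^ 2 + x) * hα + (x - α) * (x - c) * (α + 1) * hb
      + (x - α) * (α * x + α + 1) * hc
  refine ⟨?_, ?_, key⟩
  · rw [key, sub_self, mul_zero, zero_mul]
  · rw [key, sub_self, mul_zero]
end

section
/- Let a ≥ 7 be a natural number and let α < α′ < α″ be the three real roots of f_a = x³ − a·x² − (a+3)·x − 1. Then −1 − 1/a < α < −1 − 1/(2a), −1/(a+2) < α′ < −1/(a+3), and a+1 < α″ < a+1+2/a; consequently |α − α′| < 1 + 1/a, |α′ − α″| < a + 1 + 3/a, |α″ − α| < a + 2 + 3/a, and |α − α′| + |α′ − α″| + |α″ − α| < 2a + 5. -/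
theorem aux_neg (a x y z p : ℝ) (hx : x^3 - a*x^2 - (a+3)*x - 1 = 0)
    (hy : y^3 - a*y^2 - (a+3)*y - 1 = 0) (hz : z^3 - a*z^2 - (a+3)*z - 1 = 0)
    (h1 : x < y) (h2 : y < z) :
    p^3 - a*p^2 - (a+3)*p - 1 = (p-x)*(p-y)*(p-z) := by
  have e1 : x^2 + x*y + y^2 - a*(x+y) - (a+3) = 0 := by
    apply mul_left_cancel₀ (sub_ne_zero.2 h1.ne)
    linear_combination hx - hy
  have e2 : y^2 + y*z + z^2 - a*(y+z) - (a+3) = 0 := by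
    apply mul_left_cancel₀ (sub_ne_zero.2 h2.ne)
    linear_combination hy - hz
  have e3 : x + y + z - a = 0 := by
    apply mul_left_cancel₀ (sub_ne_zero.2 (h1.trans h2).ne)
    linear_combination e1 - e2
  have ha : a = x + y + z := by linarith
  subst ha
  linear_combination hx + (p - x) * e1

theorem aux_lt {x y z p : ℝ} (h1 : x < y) (h2 : y < z) (h : (p-x)*(p-y)*(p-z) < 0) :
    p < x ∨ (y < p ∧ p < z) := by
  by_contra! hc
  obtain ⟨c1, c2⟩ := hc
  rcases lt_or_ge y p with h3 | h3
  · have := c2 h3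
    have : 0 ≤ (p-x)*(p-y)*(p-z) :=
      mul_nonneg (mul_nonneg (by linarith) (by linarith)) (by linarith)
    linarith
  · have : 0 ≤ (p-x)*((y-p)*(z-p)) :=
      mul_nonneg (by linarith) (mul_nonneg (by linarith) (by linarith))
    nlinarith

theorem aux_gt {x y z p : ℝ} (h1 : x < y) (h2 : y < z) (h : 0 < (p-x)*(p-y)*(p-z)) :
    (x < p ∧ p < y) ∨ z < p := by
  have := @aux_lt (-z) (-y) (-x) (-p) (by linarith) (by linarith) (by nlinarith)
  rcases this with h | ⟨h, h'⟩
  · right; linarith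
  · left; constructor <;> linarith

/-- Let `a ≥ 7` and let `α < α′ < α″` be the three real roots of
`f_a = x³ − a·x² − (a+3)·x − 1`. Then `−1 − 1/a < α < −1 − 1/(2a)`,
`−1/(a+2) < α′ < −1/(a+3)`, and `a+1 < α″ < a+1+2/a`; consequently
`|α − α′| < 1 + 1/a`, `|α′ − α″| < a + 1 + 3/a`, `|α″ − α| < a + 2 + 3/a`, and
`|α − α′| + |α′ − α″| + |α″ − α| < 2a + 5`. -/
theorem stmt_4 (a : ℕ) (ha : 7 ≤ a) (α α' α'' : ℝ)
    (hα : α ^ 3 - (a : ℝ) * α ^ 2 - ((a : ℝ) + 3) * α - 1 = 0)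
    (hα' : α' ^ 3 - (a : ℝ) * α' ^ 2 - ((a : ℝ) + 3) * α' - 1 = 0)
    (hα'' : α'' ^ 3 - (a : ℝ) * α'' ^ 2 - ((a : ℝ) + 3) * α'' - 1 = 0)
    (hlt : α < α' ∧ α' < α'') :
    (-1 - 1 / (a : ℝ) < α ∧ α < -1 - 1 / (2 * (a : ℝ))) ∧
    (-(1 / ((a : ℝ) + 2)) < α' ∧ α' < -(1 / ((a : ℝ) + 3))) ∧
    ((a : ℝ) + 1 < α'' ∧ α'' < (a : ℝ) + 1 + 2 / (a : ℝ)) ∧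
    |α - α'| < 1 + 1 / (a : ℝ) ∧
    |α' - α''| < (a : ℝ) + 1 + 3 / (a : ℝ) ∧
    |α'' - α| < (a : ℝ) + 2 + 3 / (a : ℝ) ∧
    |α - α'| + |α' - α''| + |α'' - α| < 2 * (a : ℝ) + 5 := by
  obtain ⟨h1, h2⟩ := hlt
  have hA : (7:ℝ) ≤ a := by exact_mod_cast ha
  generalize (a:ℝ) = A at *
  have F := fun p => aux_neg A α α' α'' p hα hα' hα'' h1 h2
  have hA0 : 0 < A := by linarith
  obtain ⟨t, ht⟩ : ∃ t, t = 1 / A := ⟨_, rfl⟩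
  have hAt : A * t = 1 := by rw [ht]; field_simp
  have ht0 : 0 < t := by rw [ht]; positivity
  have ht7 : t ≤ 1/7 := by rw [ht]; gcongr
  have r1 : 1 / (2*A) = t/2 := by rw [ht]; field_simp
  have r2 : 2 / A = 2*t := by rw [ht]; field_simp
  have r3 : 3 / A = 3*t := by rw [ht]; field_simp
  have l2 : 1/(A+2) < t := by rw [ht]; gcongr; linarith
  have l3 : 1/(A+3) < 1/(A+2) := by gcongr; linarith
  have l0 : 0 < 1/(A+3) := by positivity
  have p1 : (-1-t)^3 - A*(-1-t)^2 - (A+3)*(-1-t) - 1 < 0 := by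
    have : (-1-t)^3 - A*(-1-t)^2 - (A+3)*(-1-t) - 1 = -(t+3*t^2+t^3) := by
      linear_combination (-1-t)*hAt
    rw [this]; have : 0 < t+3*t^2+t^3 := by positivity
    linarith
  have p2 : 0 < (-1-t/2)^3 - A*(-1-t/2)^2 - (A+3)*(-1-t/2) - 1 := by
    have : (-1-t/2)^3 - A*(-1-t/2)^2 - (A+3)*(-1-t/2) - 1
        = 1/2 - t/4 - 3*t^2/4 - t^3/8 := by
      linear_combination (-1/2-t/4)*hAt
    rw [this]
    have q2 : t^2 ≤ (1/7)^2 := by gcongr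
    have q3 : t^3 ≤ (1/7)^3 := by gcongr
    norm_num at q2 q3
    linarith
  have p3 : 0 < (-(1/(A+2)))^3 - A*(-(1/(A+2)))^2 - (A+3)*(-(1/(A+2))) - 1 := by
    have : (-(1/(A+2)))^3 - A*(-(1/(A+2)))^2 - (A+3)*(-(1/(A+2))) - 1 = (2*A+3)/(A+2)^3 := by
      field_simp; ring
    rw [this]; positivity
  have p4 : (-(1/(A+3)))^3 - A*(-(1/(A+3)))^2 - (A+3)*(-(1/(A+3))) - 1 < 0 := by
    have : (-(1/(A+3)))^3 - A*(-(1/(A+3)))^2 - (A+3)*(-(1/(A+3))) - 1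
        = -((1+A*(A+3))/(A+3)^3) := by
      field_simp; ring
    rw [this]; have : 0 < (1+A*(A+3))/(A+3)^3 := by positivity
    linarith
  have p5 : (A+1)^3 - A*(A+1)^2 - (A+3)*(A+1) - 1 < 0 := by nlinarith
  have p6 : 0 < (A+1+2*t)^3 - A*(A+1+2*t)^2 - (A+3)*(A+1+2*t) - 1 := by
    have : (A+1+2*t)^3 - A*(A+1+2*t)^2 - (A+3)*(A+1+2*t) - 1
        = (A+1+2*t)*(4*t+4*t^2) - 1 + 2*(A+1+2*t)*(A*t-1) := by ring
    rw [this, hAt]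
    have : (A+1+2*t)*(4*t+4*t^2) = 4*(A*t)+4*(A*t)*t + (1+2*t)*(4*t+4*t^2) := by ring
    rw [this, hAt]
    have : 0 < (1+2*t)*(4*t+4*t^2) := by positivity
    linarith
  rw [F] at p1 p2 p3 p4 p5 p6
  have g1 := aux_lt h1 h2 p1
  have g2 := aux_gt h1 h2 p2
  have g3 := aux_gt h1 h2 p3
  have g4 := aux_lt h1 h2 p4
  have g5 := aux_lt h1 h2 p5
  have g6 := aux_gt h1 h2 p6
  clear p1 p2 p3 p4 p5 p6 F
  rw [r1, r2, r3, ← ht]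
  generalize 1/(A+2) = u at *
  generalize 1/(A+3) = v at *
  have k6 : α'' < A+1+2*t := by
    rcases g6 with g | g
    · rcases g5 with h | h <;> rcases g4 with k | k <;> rcases g3 with l | l <;> linarith [g.1, g.2]
    · exact g
  have k2 : α < -1-t/2 := by
    rcases g2 with g | g
    · exact g.1
    · linarith
  have k4 : α' < -v := by
    rcases g4 with g | g
    · linarith
    · exact g.1
  have k3 : -u < α' := by
    rcases g3 with g | g
    · exact g.2
    · rcases g4 with h | h
      · linarith
      · linarith [h.2]
  have k1 : -1-t < α := by
    rcases g1 with g | g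
    · exact g
    · linarith [g.1]
  have k5 : A+1 < α'' := by
    rcases g5 with g | g
    · linarith
    · exact g.2
  rw [abs_of_neg (by linarith : α - α' < 0), abs_of_neg (by linarith : α' - α'' < 0),
    abs_of_pos (by linarith : 0 < α'' - α)]
  refine ⟨⟨k1, k2⟩, ⟨k3, k4⟩, ⟨k5, k6⟩, ?_, ?_, ?_, ?_⟩ <;> linarith
end

section
/- Let a ≥ 7 be a natural number and let α < α′ < α″ be the three real roots of f_a = x³ − a·x² − (a+3)·x − 1. Then a+2 < |1/α′| < a+3 and a+1 < |α″| < a+2. -/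
/-- Let `a ≥ 7` and let `α < α′ < α″` be the three real roots of
`f_a = x³ − a·x² − (a+3)·x − 1`. Then `a+2 < |1/α′| < a+3` and `a+1 < |α″| < a+2`. -/
theorem stmt_7 (a : ℕ) (ha : 7 ≤ a) (α α' α'' : ℝ)
    (hα : α ^ 3 - (a : ℝ) * α ^ 2 - ((a : ℝ) + 3) * α - 1 = 0)
    (hα' : α' ^ 3 - (a : ℝ) * α' ^ 2 - ((a : ℝ) + 3) * α' - 1 = 0)
    (hα'' : α'' ^ 3 - (a : ℝ) * α'' ^ 2 - ((a : ℝ) + 3) * α'' - 1 = 0)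
    (hlt : α < α' ∧ α' < α'') :
    ((a : ℝ) + 2 < |1 / α'| ∧ |1 / α'| < (a : ℝ) + 3) ∧
    ((a : ℝ) + 1 < |α''| ∧ |α''| < (a : ℝ) + 2) := by
  obtain ⟨h1, h2⟩ := hlt
  have hA : (7 : ℝ) ≤ a := by exact_mod_cast ha
  generalize (a : ℝ) = A at *
  have e1 : α ^ 2 + α * α' + α' ^ 2 - A * (α + α') - (A + 3) = 0 := by
    apply mul_left_cancel₀ (sub_ne_zero.2 h1.ne')
    linear_combination hα' - hα
  have e2 : α' ^ 2 + α' * α'' + α'' ^ 2 - A * (α' + α'') - (A + 3) = 0 := by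
    apply mul_left_cancel₀ (sub_ne_zero.2 h2.ne')
    linear_combination hα'' - hα'
  have s1 : α + α' + α'' - A = 0 := by
    apply mul_left_cancel₀ (sub_ne_zero.2 (h1.trans h2).ne')
    linear_combination e2 - e1
  have s2 : α * α' + α * α'' + α' * α'' = -(A + 3) := by
    linear_combination (α + α') * s1 - e1
  have s3 : α * α' * α'' = 1 := by
    linear_combination hα + α * s2 - α ^ 2 * s1
  have F : ∀ x, (x - α) * ((x - α') * (x - α'')) = x ^ 3 - A * x ^ 2 - (A + 3) * x - 1 := by
    intro x
    linear_combination (-x ^ 2) * s1 + x * s2 - s3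
  have pos : ∀ x, α < x → x < α'' → 0 < x ^ 3 - A * x ^ 2 - (A + 3) * x - 1 → x < α' := by
    intro x hx hx' h
    by_contra! hc
    rw [← F] at h
    have := mul_nonneg (sub_nonneg.2 hx.le) (mul_nonneg (sub_nonneg.2 hc) (sub_nonneg.2 hx'.le))
    linarith
  have neg : ∀ x, α < x → x ^ 3 - A * x ^ 2 - (A + 3) * x - 1 < 0 → α' < x ∧ x < α'' := by
    intro x hx h
    rw [← F] at h
    have h3 : (x - α') * (x - α'') < 0 := by
      by_contra! hc
      have := mul_nonneg (sub_nonneg.2 hx.le) hc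
      linarith
    rcases mul_neg_iff.1 h3 with h | h <;> constructor <;> linarith [h.1, h.2]
  have a0 : α < 0 := by
    by_contra! hc
    have p1 : 0 < α' := by linarith
    have p2 : 0 < α'' := by linarith
    have : 0 ≤ α * α' + α * α'' + α' * α'' := by positivity
    linarith
  obtain ⟨n1, n2⟩ := neg 0 a0 (by norm_num)
  have b1 := (neg (A + 1) (by linarith) (by nlinarith)).2
  have b2 : α'' < A + 2 := by
    by_contra! hc
    rcases hc.eq_or_lt with hc | hc
    · rw [← hc] at hα''
      nlinarith
    · have := pos (A + 2) (by linarith) hc (by nlinarith)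
      linarith
  have a1 : α < -1 := by
    by_contra! hc
    have h := F (-1)
    have := mul_nonneg (by linarith : 0 ≤ α + 1)
      (mul_nonneg (by linarith : 0 ≤ α' + 1) (by linarith : 0 ≤ α'' + 1))
    nlinarith
  have c1 : -(1 / (A + 2)) < α' := by
    have : 1 / (A + 2) < 1 := by rw [div_lt_one] <;> linarith
    have p : 0 < 1 / (A + 2) := by apply div_pos <;> linarith
    apply pos _ (by linarith) (by linarith)
    have : (-(1 / (A + 2))) ^ 3 - A * (-(1 / (A + 2))) ^ 2 - (A + 3) * (-(1 / (A + 2))) - 1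
        = (2 * A + 3) / (A + 2) ^ 3 := by
      have : A + 2 ≠ 0 := by linarith
      field_simp
      ring
    rw [this]
    positivity
  have c2 : α' < -(1 / (A + 3)) := by
    have : 1 / (A + 3) < 1 := by rw [div_lt_one] <;> linarith
    refine (neg _ (by linarith) ?_).1
    have : (-(1 / (A + 3))) ^ 3 - A * (-(1 / (A + 3))) ^ 2 - (A + 3) * (-(1 / (A + 3))) - 1
        = -((A * (A + 3) + 1) / (A + 3) ^ 3) := by
      have : A + 3 ≠ 0 := by linarith
      field_simp
      ring
    rw [this]
    have : 0 < (A * (A + 3) + 1) / (A + 3) ^ 3 := by positivity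
    linarith
  rw [abs_div, abs_one, abs_of_neg n1, abs_of_pos n2]
  refine ⟨⟨?_, ?_⟩, b1, b2⟩
  · rw [lt_one_div (by linarith) (by linarith)]; linarith
  · rw [one_div_lt (by linarith) (by linarith)]; linarith
end

section
/- Let a ≥ 7 be a natural number, let α be the smallest real root of f_a = x³ − a·x² − (a+3)·x − 1, K = ℚ(α), and let σ, σ′ be the two real embeddings of K sending α to α and to α′ = −(α+1)/α respectively. Then for all real numbers c₁, c₂ > 0 and every nonzero γ ∈ K there exists a unit η of the ring ℤ[α] such that c₁ ≤ |σ(γη)| < (a+3)·c₁ and c₂ ≤ |σ′(γη)| < (a+4)·c₂. -/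
/-- The cubic field `K = ℚ(α)` realized as a subfield of `ℝ`. -/
noncomputable abbrev cubicField (α : ℝ) : IntermediateField ℚ ℝ := IntermediateField.adjoin ℚ {α}

/-- The generator `α` as an element of `K = ℚ(α)`. -/
noncomputable def cubicGen (α : ℝ) : cubicField α :=
  ⟨α, IntermediateField.mem_adjoin_simple_self ℚ α⟩

/-- The subring `ℤ[α]` of `K = ℚ(α)`. -/
noncomputable abbrev intAdjoin (α : ℝ) : Subalgebra ℤ (cubicField α) :=
  Algebra.adjoin ℤ {cubicGen α}

theorem aux_desc (e L : ℝ) (he : 0 < e) (hL : 0 < L) (N : ℕ) :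
    ∀ X Y : ℝ, 0 ≤ X → X < L + e → 0 ≤ Y → Y < N * e →
    ∃ m n : ℤ, (0 ≤ X + m * e - n * L ∧ X + m * e - n * L < L + e) ∧
      (0 ≤ Y - m * (L + e) - n * e ∧ Y - m * (L + e) - n * e < L + e) := by
  induction N with
  | zero => intro X Y _ _ h1 h2; simp at h2; linarith
  | succ N ih =>
    intro X Y hX0 hX1 hY0 hY1
    push_cast at hY1
    by_cases hY : Y < L + e
    · exact ⟨0, 0, by simp [hX0, hX1], by simp [hY0, hY]⟩
    push Not at hY
    by_cases hX : X < L
    · obtain ⟨m, n, h⟩ := ih (X + e) (Y - (L + e)) (by linarith) (by linarith) (by linarith)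
        (by linarith)
      refine ⟨m + 1, n, ?_⟩
      push_cast
      refine ⟨⟨?_, ?_⟩, ?_, ?_⟩ <;> linarith [h.1.1, h.1.2, h.2.1, h.2.2]
    · push Not at hX
      obtain ⟨m, n, h⟩ := ih (X - L) (Y - e) (by linarith) (by linarith) (by linarith)
        (by linarith)
      refine ⟨m, n + 1, ?_⟩
      push_cast
      refine ⟨⟨?_, ?_⟩, ?_, ?_⟩ <;> linarith [h.1.1, h.1.2, h.2.1, h.2.2]

theorem aux_asc (e L : ℝ) (he : 0 < e) (hL : 0 < L) (N : ℕ) :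
    ∀ X Y : ℝ, 0 ≤ X → X < L + e → -Y < N * e →
    ∃ m n : ℤ, (0 ≤ X + m * e - n * L ∧ X + m * e - n * L < L + e) ∧
      (0 ≤ Y - m * (L + e) - n * e) := by
  induction N with
  | zero =>
    intro X Y h0 h1 h2
    refine ⟨0, 0, ?_⟩
    simp at h2 ⊢
    exact ⟨⟨h0, h1⟩, h2.le⟩
  | succ N ih =>
    intro X Y hX0 hX1 hY1
    push_cast at hY1
    by_cases hX : e ≤ X
    · obtain ⟨m, n, h⟩ := ih (X - e) (Y + (L + e)) (by linarith) (by linarith) (by linarith)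
      refine ⟨m - 1, n, ?_⟩
      push_cast
      refine ⟨⟨?_, ?_⟩, ?_⟩ <;> linarith [h.1.1, h.1.2, h.2]
    · push Not at hX
      obtain ⟨m, n, h⟩ := ih (X + L) (Y + e) (by linarith) (by linarith) (by linarith)
      refine ⟨m, n - 1, ?_⟩
      push_cast
      refine ⟨⟨?_, ?_⟩, ?_⟩ <;> linarith [h.1.1, h.1.2, h.2]

theorem aux_lat (e L : ℝ) (he : 0 < e) (hL : 0 < L) (X Y : ℝ) :
    ∃ m n : ℤ, (0 ≤ X + m * e - n * L ∧ X + m * e - n * L < L + e) ∧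
      (0 ≤ Y - m * (L + e) - n * e ∧ Y - m * (L + e) - n * e < L + e) := by
  have hM : 0 < L + e := by linarith
  obtain ⟨k, hk, -⟩ := existsUnique_sub_zsmul_mem_Ico hM X 0
  simp only [zsmul_eq_mul, zero_add, Set.mem_Ico] at hk
  obtain ⟨N, hN⟩ := exists_nat_gt (-(Y + k * L) / e)
  rw [div_lt_iff₀ he] at hN
  obtain ⟨m, n, h, h'⟩ := aux_asc e L he hL N _ (Y + k * L) hk.1 hk.2 hN
  obtain ⟨N', hN'⟩ := exists_nat_gt ((Y + k * L - m * (L + e) - n * e) / e)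
  rw [div_lt_iff₀ he] at hN'
  obtain ⟨m', n', g⟩ := aux_desc e L he hL N' _ _ h.1 h.2 h' hN'
  refine ⟨m + m' - k, n + n' + k, ?_⟩
  push_cast
  refine ⟨⟨?_, ?_⟩, ?_, ?_⟩ <;> linarith [g.1.1, g.1.2, g.2.1, g.2.2]

theorem aux_real (a α : ℝ) (ha : 7 ≤ a)
    (hα : α ^ 3 - a * α ^ 2 - (a + 3) * α - 1 = 0)
    (hmin : ∀ x : ℝ, x ^ 3 - a * x ^ 2 - (a + 3) * x - 1 = 0 → α ≤ x) :
    -2 < α ∧ α < -1 - 1 / (a + 2) := by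
  constructor
  · by_contra h
    push Not at h
    nlinarith [sq_nonneg α, mul_nonneg (sq_nonneg α) (by linarith : (0:ℝ) ≤ -2 - α),
      mul_nonneg (by linarith : 0 ≤ -2 - α) (by linarith : (0:ℝ) ≤ a), 
      mul_nonneg (mul_self_nonneg (-2 - α)) (by linarith : (0:ℝ) ≤ a)]
  · have hs : 0 < 1 / (a + 2) := by positivity
    have hs1 : 1 / (a + 2) ≤ 1 / 9 := by
      apply one_div_le_one_div_of_le <;> linarith
    have hst : (a + 2) * (1 / (a + 2)) = 1 := by field_simp
    set t := 1 / (a + 2) with ht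
    have hpos : 0 < (-1 - t) ^ 3 - a * (-1 - t) ^ 2 - (a + 3) * (-1 - t) - 1 := by
      have : (-1 - t) ^ 3 - a * (-1 - t) ^ 2 - (a + 3) * (-1 - t) - 1 = t * (1 - t - t ^ 2) := by
        linear_combination (-1 - t) * hst
      rw [this]
      apply mul_pos hs
      nlinarith
    have hc : ContinuousOn (fun x : ℝ => x ^ 3 - a * x ^ 2 - (a + 3) * x - 1)
        (Set.Icc (-2) (-1 - t)) := by fun_prop
    obtain ⟨x, hx, hx0⟩ := intermediate_value_Ioo (by linarith) hc
      (show (0:ℝ) ∈ Set.Ioo _ _ from ⟨by norm_num; nlinarith, hpos⟩)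
    exact (hmin x hx0).trans_lt hx.2

theorem aux_log (α : ℝ) (φ : cubicField α →+* ℝ) (γ : cubicField α) (hγ : γ ≠ 0)
    (u v : (intAdjoin α)ˣ) (m n : ℤ) (c : ℝ) (hc : 0 < c) (D U V : ℝ) (d : ℝ)
    (hU : Real.log |φ ((u : intAdjoin α) : cubicField α)| = U)
    (hV : Real.log |φ ((v : intAdjoin α) : cubicField α)| = V)
    (hD : Real.exp D < d)
    (h0 : 0 ≤ (Real.log |φ γ| - Real.log c) + m * U + n * V)
    (h1 : (Real.log |φ γ| - Real.log c) + m * U + n * V < D) :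
    c ≤ |φ (γ * ((u ^ m * v ^ n : (intAdjoin α)ˣ) : intAdjoin α))| ∧
    |φ (γ * ((u ^ m * v ^ n : (intAdjoin α)ˣ) : intAdjoin α))| < d * c := by
  have hne : ∀ w : (intAdjoin α)ˣ, |φ ((w : intAdjoin α) : cubicField α)| ≠ 0 := by
    intro w
    have := (w.map ((φ.comp (intAdjoin α).val.toRingHom : intAdjoin α →+* ℝ) :
      intAdjoin α →* ℝ)).ne_zero
    exact abs_ne_zero.mpr this
  have hz : ∀ (w : (intAdjoin α)ˣ) (k : ℤ), φ (((w ^ k : (intAdjoin α)ˣ) : intAdjoin α) : cubicField α)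
      = φ ((w : intAdjoin α) : cubicField α) ^ k := by
    intro w k
    have := congrArg Units.val (map_zpow (Units.map ((φ.comp (intAdjoin α).val.toRingHom :
      intAdjoin α →+* ℝ) : intAdjoin α →* ℝ)) w k)
    rw [Units.val_zpow_eq_zpow_val] at this
    exact this
  have hg : |φ γ| ≠ 0 := abs_ne_zero.mpr ((map_ne_zero φ).mpr hγ)
  have key : |φ (γ * ((u ^ m * v ^ n : (intAdjoin α)ˣ) : intAdjoin α))|
      = |φ γ| * (|φ ((u : intAdjoin α) : cubicField α)| ^ m *
        |φ ((v : intAdjoin α) : cubicField α)| ^ n) := by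
    rw [Units.val_mul, MulMemClass.coe_mul, map_mul, map_mul, hz, hz, abs_mul, abs_mul, abs_zpow,
      abs_zpow]
  have hpos : 0 < |φ (γ * ((u ^ m * v ^ n : (intAdjoin α)ˣ) : intAdjoin α))| := by
    rw [key]
    have := hne u
    have := hne v
    positivity
  have hlog : Real.log |φ (γ * ((u ^ m * v ^ n : (intAdjoin α)ˣ) : intAdjoin α))| =
      Real.log |φ γ| + (m * U + n * V) := by
    rw [key, Real.log_mul hg (mul_ne_zero (zpow_ne_zero _ (hne u)) (zpow_ne_zero _ (hne v))),
      Real.log_mul (zpow_ne_zero _ (hne u)) (zpow_ne_zero _ (hne v)), Real.log_zpow,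
      Real.log_zpow, hU, hV]
  constructor
  · rw [← Real.log_le_log_iff hc hpos, hlog]; linarith
  · have hd : 0 < d := (Real.exp_pos D).trans hD
    rw [← Real.log_lt_log_iff hpos (by positivity), hlog, Real.log_mul hd.ne' hc.ne']
    have := (Real.lt_log_iff_exp_lt hd).mpr hD
    linarith

/-- Let `a ≥ 7`, let `α` be the smallest real root of
`f_a = x³ − a·x² − (a+3)·x − 1`, `K = ℚ(α)` (realized as a subfield of `ℝ`, so that the
real embedding `σ` with `σ(α) = α` is the inclusion), and let `σ′ : K → ℝ` be the real
embedding with `σ′(α) = α′ = −(α+1)/α`. Then for all real `c₁, c₂ > 0` and every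
nonzero `γ ∈ K` there exists a unit `η` of the ring `ℤ[α]` such that
`c₁ ≤ |σ(γη)| < (a+3)·c₁` and `c₂ ≤ |σ′(γη)| < (a+4)·c₂`. -/
theorem stmt_8 (a : ℕ) (ha : 7 ≤ a) (α : ℝ)
    (hα : α ^ 3 - (a : ℝ) * α ^ 2 - ((a : ℝ) + 3) * α - 1 = 0)
    (hmin : ∀ x : ℝ, x ^ 3 - (a : ℝ) * x ^ 2 - ((a : ℝ) + 3) * x - 1 = 0 → α ≤ x)
    (σ' : cubicField α →+* ℝ) (hσ' : σ' (cubicGen α) = -(α + 1) / α)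
    (c₁ c₂ : ℝ) (hc₁ : 0 < c₁) (hc₂ : 0 < c₂)
    (γ : cubicField α) (hγ : γ ≠ 0) :
    ∃ η : (intAdjoin α)ˣ,
      (c₁ ≤ |((γ * ((η : intAdjoin α) : cubicField α) : cubicField α) : ℝ)| ∧
        |((γ * ((η : intAdjoin α) : cubicField α) : cubicField α) : ℝ)|
          < ((a : ℝ) + 3) * c₁) ∧
      (c₂ ≤ |σ' (γ * ((η : intAdjoin α) : cubicField α))| ∧
        |σ' (γ * ((η : intAdjoin α) : cubicField α))| < ((a : ℝ) + 4) * c₂) := by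
  have ha' : (7 : ℝ) ≤ a := by exact_mod_cast ha
  obtain ⟨h2, h1⟩ := aux_real a α ha' hα hmin
  have hs : 0 < 1 / ((a : ℝ) + 2) := by positivity
  have hgen : (cubicGen α) ^ 3 - (a : cubicField α) * (cubicGen α) ^ 2
      - ((a : cubicField α) + 3) * (cubicGen α) - 1 = 0 := by
    apply Subtype.ext
    have h3 : ((3 : cubicField α) : ℝ) = 3 := map_ofNat (algebraMap (cubicField α) ℝ) 3
    simpa [cubicGen, h3] using hα
  obtain ⟨g, hg⟩ : ∃ g : intAdjoin α, (g : cubicField α) = cubicGen α :=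
    ⟨⟨cubicGen α, Algebra.subset_adjoin (Set.mem_singleton _)⟩, rfl⟩
  have hgg : g ^ 3 - (a : intAdjoin α) * g ^ 2 - ((a : intAdjoin α) + 3) * g - 1 = 0 := by
    apply Subtype.ext
    push_cast
    rw [hg]
    exact hgen
  let u : (intAdjoin α)ˣ := Units.mkOfMulEqOne g (g ^ 2 - a * g - (a + 3))
    (by linear_combination hgg)
  let v : (intAdjoin α)ˣ := Units.mkOfMulEqOne (g + 1) (-(g ^ 2 - (a + 1) * g - 2))
    (by linear_combination -hgg)
  have hu : ((u : intAdjoin α) : cubicField α) = cubicGen α := hg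
  have hv : ((v : intAdjoin α) : cubicField α) = cubicGen α + 1 := by
    show ((g + 1 : intAdjoin α) : cubicField α) = _
    push_cast
    rw [hg]
  have hA : 0 < Real.log (-α) := Real.log_pos (by linarith)
  have hC : 0 < -Real.log (-(α + 1)) := by
    have := Real.log_neg (x := -(α + 1)) (by linarith) (by linarith)
    linarith
  have hα0 : -α ≠ 0 := by linarith
  have hα1 : -(α + 1) ≠ 0 := by linarith
  have hexp : Real.exp (-Real.log (-(α + 1)) + Real.log (-α)) < a + 3 := by
    rw [Real.exp_add, Real.exp_neg, Real.exp_log (by linarith), Real.exp_log (by linarith),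
      inv_mul_lt_iff₀ (by linarith)]
    have hst : ((a : ℝ) + 2) * (1 / (a + 2)) = 1 := by field_simp
    nlinarith
  obtain ⟨m, n, hX, hY⟩ := aux_lat _ _ hA hC
    (Real.log |(γ : ℝ)| - Real.log c₁) (Real.log |σ' γ| - Real.log c₂)
  refine ⟨u ^ m * v ^ n, ?_, ?_⟩
  · refine aux_log α (algebraMap (cubicField α) ℝ) γ hγ u v m n c₁ hc₁ _ (Real.log (-α))
      (Real.log (-(α + 1))) _ ?_ ?_ hexp ?_ ?_
    · rw [hu]
      show Real.log |α| = _
      rw [abs_of_neg (by linarith)]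
    · rw [hv]
      show Real.log |α + 1| = _
      rw [abs_of_neg (by linarith)]
    · have := hX.1
      show 0 ≤ (Real.log |(γ : ℝ)| - Real.log c₁) + _ + _
      linarith
    · have := hX.2
      show (Real.log |(γ : ℝ)| - Real.log c₁) + _ + _ < _
      linarith
  · refine aux_log α σ' γ hγ u v m n c₂ hc₂ _ (Real.log (-(α + 1)) - Real.log (-α))
      (-Real.log (-α)) _ ?_ ?_ (hexp.trans (by linarith)) ?_ ?_
    · rw [hu, hσ', abs_div, Real.log_div (by simpa using hα1) (by simpa using hα0), abs_neg,
        abs_of_neg (by linarith), abs_of_neg (by linarith : α < 0)]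
    · have h0 : α ≠ 0 := by linarith
      have : σ' (cubicGen α + 1) = (-α)⁻¹ := by
        rw [map_add, map_one, hσ']
        field_simp
        ring
      rw [hv, this, abs_of_pos (inv_pos.mpr (by linarith)), Real.log_inv]
    · linarith [hY.1]
    · linarith [hY.2]
end

section
/- Let a ≥ 1 be a natural number, α a root of f_a = x³ − a·x² − (a+3)·x − 1, K = ℚ(α), and α′ = −(α+1)/α. Then for all integers r, s, t, the norm N_{K/ℚ}(r + s·α + t·α′) equals r³ + s³ + t³ + a·r²·s + a·r²·t + 3·s·t² − (a²+3a+6)·s²·t − (a+3)·r·t² − (a+3)·r·s² + (a²+a+3)·r·s·t. -/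
open Polynomial in
/-- Let `a ≥ 1`, `α` a root of the (irreducible) polynomial
`f_a = x³ − a·x² − (a+3)·x − 1`, `K = ℚ(α)`, and `α′ = −(α+1)/α`. Then for all
integers `r, s, t`, the norm `N_{K/ℚ}(r + s·α + t·α′)` equals
`r³ + s³ + t³ + a·r²·s + a·r²·t + 3·s·t² − (a²+3a+6)·s²·t − (a+3)·r·t² − (a+3)·r·s²
  + (a²+a+3)·r·s·t`. -/
theorem stmt_9 (a : ℕ) (ha : 1 ≤ a)
    (hirr : Irreducible (X ^ 3 - C (a : ℚ) * X ^ 2 - C ((a : ℚ) + 3) * X - C 1))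
    (K : Type*) [Field K] [NumberField K]
    (α : K) (hα : α ^ 3 - (a : K) * α ^ 2 - ((a : K) + 3) * α - 1 = 0)
    (hgen : IntermediateField.adjoin ℚ {α} = ⊤)
    (r s t : ℤ) :
    Algebra.norm ℚ ((r : K) + (s : K) * α + (t : K) * (-(α + 1) / α))
      = (r : ℚ) ^ 3 + (s : ℚ) ^ 3 + (t : ℚ) ^ 3 + (a : ℚ) * r ^ 2 * s
        + (a : ℚ) * r ^ 2 * t + 3 * s * t ^ 2
        - ((a : ℚ) ^ 2 + 3 * a + 6) * s ^ 2 * t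
        - ((a : ℚ) + 3) * r * t ^ 2 - ((a : ℚ) + 3) * r * s ^ 2
        + ((a : ℚ) ^ 2 + a + 3) * r * s * t := by
  have hα0 : α ≠ 0 := by
    rintro rfl
    norm_num at hα
  have hmon : (X ^ 3 - C (a : ℚ) * X ^ 2 - C ((a : ℚ) + 3) * X - C 1).Monic := by
    monicity!
  have hdeg : (X ^ 3 - C (a : ℚ) * X ^ 2 - C ((a : ℚ) + 3) * X - C 1).natDegree = 3 := by
    compute_degree!
  have hmin : minpoly ℚ α = X ^ 3 - C (a : ℚ) * X ^ 2 - C ((a : ℚ) + 3) * X - C 1 := by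
    refine (minpoly.eq_of_irreducible_of_monic hirr ?_ hmon).symm
    simpa using hα
  have hint : IsIntegral ℚ α := Algebra.IsIntegral.isIntegral α
  have htop : Algebra.adjoin ℚ {α} = ⊤ := by
    rw [← IntermediateField.adjoin_simple_toSubalgebra_of_isAlgebraic hint.isAlgebraic, hgen]
    rfl
  let pb := PowerBasis.ofAdjoinEqTop hint htop
  have hgenpb : pb.gen = α := PowerBasis.ofAdjoinEqTop_gen hint htop
  have hdim : pb.dim = 3 := by
    rw [← pb.natDegree_minpoly, hgenpb, hmin, hdeg]
  let b := pb.basis.reindex (finCongr hdim)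
  have hb : ∀ i : Fin 3, b i = α ^ (i : ℕ) := by
    intro i
    simp [b, hgenpb]
  have hinv : -(α + 1) / α = -α ^ 2 + a * α + (a + 2) := by
    rw [div_eq_iff hα0]
    linear_combination hα
  rw [hinv, Algebra.norm_eq_matrix_det b]
  obtain ⟨c0, h0⟩ : ∃ c : ℚ, c = r + t * (a + 2) := ⟨_, rfl⟩
  obtain ⟨c1, h1⟩ : ∃ c : ℚ, c = s + t * a := ⟨_, rfl⟩
  obtain ⟨c2, h2⟩ : ∃ c : ℚ, c = -t := ⟨_, rfl⟩
  obtain ⟨d1, e1⟩ : ∃ c : ℚ, c = c1 + a * c2 := ⟨_, rfl⟩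
  have key : Algebra.leftMulMatrix b
      ((r : K) + (s : K) * α + (t : K) * (-α ^ 2 + a * α + (a + 2))) =
      !![c0, c2, d1;
         c1, c0 + (a + 3) * c2, c2 + (a + 3) * d1;
         c2, d1, c0 + (a + 3) * c2 + a * d1] := by
    ext i j
    rw [Algebra.leftMulMatrix_eq_repr_mul]
    have : ((r : K) + (s : K) * α + (t : K) * (-α ^ 2 + a * α + (a + 2))) * b j =
        ∑ k, (!![c0, c2, d1;
         c1, c0 + (a + 3) * c2, c2 + (a + 3) * d1;
         c2, d1, c0 + (a + 3) * c2 + a * d1] k j) • b k := by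
      fin_cases j <;>
        simp [Fin.sum_univ_three, hb, Algebra.smul_def, h0, h1, h2, e1]
      · ring
      · linear_combination (-(t : K)) * hα
      · linear_combination (-(t : K) * α + s) * hα
    rw [this, Module.Basis.repr_sum_self]
  rw [key, Matrix.det_fin_three]
  simp [h0, h1, h2, e1]
  ring
end

section
/- Let a ≥ 1 be a natural number, α a root of f_a = x³ − a·x² − (a+3)·x − 1, K = ℚ(α), α′ = −(α+1)/α, and m = a²+3a+9. Then for every integer r, N_{K/ℚ}(r + α − α′) = r³ − m·r + m; in particular this norm equals 1 for r = 1, equals −a²−3a−1 for r = 2, equals −6a+1 for r = a+1, equals 2a²−1 for r = a+2, equals 6a+19 for r = −a−2, and equals −2a²−6a+9 for r = −a−3. -/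
open Polynomial in
/-- Let `a ≥ 1`, `α` a root of the (irreducible) polynomial
`f_a = x³ − a·x² − (a+3)·x − 1`, `K = ℚ(α)`, `α′ = −(α+1)/α`, and `m = a²+3a+9`.
Then for every integer `r`, `N_{K/ℚ}(r + α − α′) = r³ − m·r + m`; in particular this
norm equals `1` for `r = 1`, `−a²−3a−1` for `r = 2`, `−6a+1` for `r = a+1`,
`2a²−1` for `r = a+2`, `6a+19` for `r = −a−2`, and `−2a²−6a+9` for `r = −a−3`. -/
theorem stmt_12 (a : ℕ) (ha : 1 ≤ a)
    (hirr : Irreducible (X ^ 3 - C (a : ℚ) * X ^ 2 - C ((a : ℚ) + 3) * X - C 1))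
    (K : Type*) [Field K] [NumberField K]
    (α : K) (hα : α ^ 3 - (a : K) * α ^ 2 - ((a : K) + 3) * α - 1 = 0)
    (hgen : IntermediateField.adjoin ℚ {α} = ⊤) :
    (∀ r : ℤ, Algebra.norm ℚ ((r : K) + α - (-(α + 1) / α))
        = (r : ℚ) ^ 3 - ((a : ℚ) ^ 2 + 3 * a + 9) * r + ((a : ℚ) ^ 2 + 3 * a + 9)) ∧
    Algebra.norm ℚ ((1 : K) + α - (-(α + 1) / α)) = 1 ∧
    Algebra.norm ℚ ((2 : K) + α - (-(α + 1) / α)) = -(a : ℚ) ^ 2 - 3 * a - 1 ∧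
    Algebra.norm ℚ (((a : K) + 1) + α - (-(α + 1) / α)) = -6 * (a : ℚ) + 1 ∧
    Algebra.norm ℚ (((a : K) + 2) + α - (-(α + 1) / α)) = 2 * (a : ℚ) ^ 2 - 1 ∧
    Algebra.norm ℚ ((-(a : K) - 2) + α - (-(α + 1) / α)) = 6 * (a : ℚ) + 19 ∧
    Algebra.norm ℚ ((-(a : K) - 3) + α - (-(α + 1) / α))
      = -2 * (a : ℚ) ^ 2 - 6 * a + 9 := by
  have hf : (X ^ 3 - C (a : ℚ) * X ^ 2 - C ((a : ℚ) + 3) * X - C 1 : ℚ[X]).Monic := by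
    monicity!
  have hdeg : (X ^ 3 - C (a : ℚ) * X ^ 2 - C ((a : ℚ) + 3) * X - C 1 : ℚ[X]).natDegree = 3 := by
    compute_degree!
  have hmin : minpoly ℚ α = X ^ 3 - C (a : ℚ) * X ^ 2 - C ((a : ℚ) + 3) * X - C 1 := by
    symm
    apply minpoly.eq_of_irreducible_of_monic hirr _ hf
    simpa using hα
  have hint : IsIntegral ℚ α := Algebra.IsIntegral.isIntegral α
  have hadj : Algebra.adjoin ℚ {α} = ⊤ := by
    rw [← IntermediateField.adjoin_simple_toSubalgebra_of_isAlgebraic hint.isAlgebraic, hgen]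
    rfl
  obtain ⟨pb, hpb⟩ : ∃ pb : PowerBasis ℚ K, pb.gen = α :=
    ⟨PowerBasis.ofAdjoinEqTop hint hadj, by simp⟩
  have hdim : pb.dim = 3 := by
    rw [← pb.natDegree_minpoly, hpb, hmin, hdeg]
  let b : Module.Basis (Fin 3) ℚ K := pb.basis.reindex (finCongr hdim)
  have hb : ∀ i : Fin 3, b i = α ^ (i : ℕ) := by
    intro i
    simp [b, hpb]
  have hα0 : α ≠ 0 := by
    rintro rfl
    simp at hα
  have hA : Algebra.leftMulMatrix b α = !![0, 0, 1; 1, 0, (a : ℚ) + 3; 0, 1, (a : ℚ)] := by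
    ext i j
    rw [Algebra.leftMulMatrix_eq_repr_mul]
    have h3 : α * b 2 = b 0 + ((a : ℚ) + 3) • b 1 + (a : ℚ) • b 2 := by
      simp only [hb, Algebra.smul_def]
      simp
      linear_combination hα
    have h1 : α * b 0 = b 1 := by simp [hb]
    have h2 : α * b 1 = b 2 := by simp [hb]; ring
    fin_cases j
    · simp only [Fin.zero_eta, h1]
      fin_cases i <;> simp
    · simp only [Fin.mk_one, h2]
      fin_cases i <;> simp
    · simp only [Fin.reduceFinMk, h3]
      fin_cases i <;> simp
  have key : ∀ q : ℚ, Algebra.norm ℚ (algebraMap ℚ K q + α - (-(α + 1) / α))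
        = q ^ 3 - ((a : ℚ) ^ 2 + 3 * a + 9) * q + ((a : ℚ) ^ 2 + 3 * a + 9) := by
    intro q
    have e : algebraMap ℚ K q + α - (-(α + 1) / α)
        = α * α + (1 - (a : ℚ)) • α + algebraMap ℚ K (q - a - 2) := by
      simp only [Algebra.smul_def]
      simp
      field_simp
      linear_combination -hα
    rw [e, Algebra.norm_eq_matrix_det b, map_add, map_add, map_mul, map_smul, AlgHom.commutes, hA,
      Matrix.algebraMap_eq_diagonal, Matrix.det_fin_three]
    simp [Matrix.mul_apply, Fin.sum_univ_three, Matrix.diagonal]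
    ring
  refine ⟨fun r => ?_, ?_, ?_, ?_, ?_, ?_, ?_⟩
  · simpa using key r
  · have := key 1
    simp only [map_one] at this
    rw [this]; ring
  · have := key 2
    simp only [map_ofNat] at this
    rw [this]; ring
  · have := key (a + 1)
    simp only [map_add, map_natCast, map_one] at this
    rw [this]; ring
  · have := key (a + 2)
    simp only [map_add, map_natCast, map_ofNat] at this
    rw [this]; ring
  · have := key (-a - 2)
    simp only [map_sub, map_neg, map_natCast, map_ofNat] at this
    rw [this]; ring
  · have := key (-a - 3)
    simp only [map_sub, map_neg, map_natCast, map_ofNat] at this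
    rw [this]; ring
end

section
/- Let a ≥ 1 be a natural number, α a root of f_a = x³ − a·x² − (a+3)·x − 1, K = ℚ(α), α′ = −(α+1)/α, and m = a²+3a+9. Then for every integer r, N_{K/ℚ}(r + 2α − 2α′) = r³ − 4m·r + 8m; in particular this norm equals 4a²+12a+37 for r = 1, equals −4a²−12a−9 for r = 3, equals −8a²−54a+37 for r = 2a+1, equals 8a²−30a−9 for r = 2a+3, equals 8a²+78a+153 for r = −2a−3, and equals −8a²+6a+127 for r = −2a−5. -/
open Polynomial in
theorem aux_norm (a : ℕ)
    (hirr : Irreducible (X ^ 3 - C (a : ℚ) * X ^ 2 - C ((a : ℚ) + 3) * X - C 1))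
    (K : Type*) [Field K] [NumberField K]
    (α : K) (hα : α ^ 3 - (a : K) * α ^ 2 - ((a : K) + 3) * α - 1 = 0)
    (hgen : IntermediateField.adjoin ℚ {α} = ⊤) (r : ℚ) :
    Algebra.norm ℚ ((r : K) + 2 * α - 2 * (-(α + 1) / α))
        = (r : ℚ) ^ 3 - 4 * ((a : ℚ) ^ 2 + 3 * a + 9) * r
          + 8 * ((a : ℚ) ^ 2 + 3 * a + 9) := by
  have hα0 : α ≠ 0 := by
    rintro rfl
    norm_num at hα
  have hint : IsIntegral ℚ α := IsIntegral.of_finite ℚ α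
  have hdeg : (X ^ 3 - C (a : ℚ) * X ^ 2 - C ((a : ℚ) + 3) * X - C 1).natDegree = 3 := by
    compute_degree!
  have hmonic : (X ^ 3 - C (a : ℚ) * X ^ 2 - C ((a : ℚ) + 3) * X - C 1).Monic := by
    monicity!
  have hmin := minpoly.eq_of_irreducible_of_monic hirr (x := α)
    (by simpa using hα) hmonic
  have hnd : (minpoly ℚ α).natDegree = 3 := by rw [← hmin, hdeg]
  have hfr : Module.finrank ℚ K = 3 := by
    rw [← IntermediateField.finrank_top', ← hgen, IntermediateField.adjoin.finrank hint, hnd]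
  have hli : LinearIndependent ℚ (fun i : Fin 3 => α ^ (i : ℕ)) := by
    have h := linearIndependent_pow (K := ℚ) α
    rw [hnd] at h
    exact h
  let b : Module.Basis (Fin 3) ℚ K :=
    basisOfLinearIndependentOfCardEqFinrank hli (by simp [hfr])
  have hb : ∀ i : Fin 3, b i = α ^ (i : ℕ) := by
    intro i
    simp [b]
  let M : Matrix (Fin 3) (Fin 3) ℚ :=
    !![r - 2 * a - 4, 2, 2; 2 - 2 * a, r + 2, 2 * a + 8; 2, 2, r + 2 + 2 * a]
  have hβ : (r : K) + 2 * α - 2 * (-(α + 1) / α)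
      = (r - 2 * a - 4) + (2 - 2 * a) * α + 2 * α ^ 2 := by
    field_simp
    linear_combination (-2) * hα
  have hM : LinearMap.mulLeft ℚ ((r : K) + 2 * α - 2 * (-(α + 1) / α)) = Matrix.toLin b b M := by
    apply b.ext
    intro j
    rw [Matrix.toLin_self, LinearMap.mulLeft_apply, hβ]
    simp only [Fin.sum_univ_three, hb, Algebra.smul_def, eq_ratCast]
    fin_cases j
    · simp [M]
    · simp [M]
      linear_combination 2 * hα
    · simp [M]
      linear_combination (2 * α + 2) * hα
  have hdet : Algebra.norm ℚ ((r : K) + 2 * α - 2 * (-(α + 1) / α)) = M.det := by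
    rw [Algebra.norm_apply, ← LinearMap.det_toLin b M, ← hM]
    rfl
  rw [hdet, Matrix.det_fin_three]
  simp [M]
  ring

open Polynomial in
/-- Let `a ≥ 1`, `α` a root of the (irreducible) polynomial
`f_a = x³ − a·x² − (a+3)·x − 1`, `K = ℚ(α)`, `α′ = −(α+1)/α`, and `m = a²+3a+9`.
Then for every integer `r`, `N_{K/ℚ}(r + 2α − 2α′) = r³ − 4m·r + 8m`; in particular
this norm equals `4a²+12a+37` for `r = 1`, `−4a²−12a−9` for `r = 3`,
`−8a²−54a+37` for `r = 2a+1`, `8a²−30a−9` for `r = 2a+3`, `8a²+78a+153` for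
`r = −2a−3`, and `−8a²+6a+127` for `r = −2a−5`. -/
theorem stmt_14 (a : ℕ) (ha : 1 ≤ a)
    (hirr : Irreducible (X ^ 3 - C (a : ℚ) * X ^ 2 - C ((a : ℚ) + 3) * X - C 1))
    (K : Type*) [Field K] [NumberField K]
    (α : K) (hα : α ^ 3 - (a : K) * α ^ 2 - ((a : K) + 3) * α - 1 = 0)
    (hgen : IntermediateField.adjoin ℚ {α} = ⊤) :
    (∀ r : ℤ, Algebra.norm ℚ ((r : K) + 2 * α - 2 * (-(α + 1) / α))
        = (r : ℚ) ^ 3 - 4 * ((a : ℚ) ^ 2 + 3 * a + 9) * r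
          + 8 * ((a : ℚ) ^ 2 + 3 * a + 9)) ∧
    Algebra.norm ℚ ((1 : K) + 2 * α - 2 * (-(α + 1) / α))
      = 4 * (a : ℚ) ^ 2 + 12 * a + 37 ∧
    Algebra.norm ℚ ((3 : K) + 2 * α - 2 * (-(α + 1) / α))
      = -4 * (a : ℚ) ^ 2 - 12 * a - 9 ∧
    Algebra.norm ℚ ((2 * (a : K) + 1) + 2 * α - 2 * (-(α + 1) / α))
      = -8 * (a : ℚ) ^ 2 - 54 * a + 37 ∧
    Algebra.norm ℚ ((2 * (a : K) + 3) + 2 * α - 2 * (-(α + 1) / α))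
      = 8 * (a : ℚ) ^ 2 - 30 * a - 9 ∧
    Algebra.norm ℚ ((-2 * (a : K) - 3) + 2 * α - 2 * (-(α + 1) / α))
      = 8 * (a : ℚ) ^ 2 + 78 * a + 153 ∧
    Algebra.norm ℚ ((-2 * (a : K) - 5) + 2 * α - 2 * (-(α + 1) / α))
      = -8 * (a : ℚ) ^ 2 + 6 * a + 127 := by
  have key := aux_norm a hirr K α hα hgen
  refine ⟨fun r => ?_, ?_, ?_, ?_, ?_, ?_, ?_⟩
  · have h := key r
    push_cast at h
    exact h
  · have h := key (1)
    push_cast at h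
    rw [h]
    ring
  · have h := key (3)
    push_cast at h
    rw [h]
    ring
  · have h := key (2 * a + 1)
    push_cast at h
    rw [h]
    ring
  · have h := key (2 * a + 3)
    push_cast at h
    rw [h]
    ring
  · have h := key (-2 * a - 3)
    push_cast at h
    rw [h]
    ring
  · have h := key (-2 * a - 5)
    push_cast at h
    rw [h]
    ring
end

section
/- Let a ≥ 1 be a natural number, α a root of f_a = x³ − a·x² − (a+3)·x − 1, and denote by β ↦ β′ the field automorphism of K = ℚ(α) sending α to α′ = −(α+1)/α, and β″ = (β′)′. Then the following identities hold in K: α+2 = −(α−1)″·(α+1); α−(a+1) = −(α−1)′/(α+1); 2α+1 = −(α−1)′·α; α+α′−a+1 = −(α−1)″; α+α′−a−2 = (α−1)′·α/(α+1); α+α′+1 = (α−1)·(α+1)/α; 2α−α′+2 = −(α−1)′·(α+1); and 2α+2α′−2a−1 = −(α−1)/(α+1). In particular each of these elements is the product of a conjugate of α−1 with a unit of ℤ[α]. -/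
open Polynomial in
/-- Let `a ≥ 1`, `α` a root of the (irreducible) polynomial
`f_a = x³ − a·x² − (a+3)·x − 1`, and denote by `β ↦ σ β` the field automorphism of
`K = ℚ(α)` sending `α` to `α′ = −(α+1)/α`, with `β″ = σ (σ β)`. Then the following
identities hold in `K`:
`α+2 = −(α−1)″·(α+1)`; `α−(a+1) = −(α−1)′/(α+1)`; `2α+1 = −(α−1)′·α`;
`α+α′−a+1 = −(α−1)″`; `α+α′−a−2 = (α−1)′·α/(α+1)`; `α+α′+1 = (α−1)·(α+1)/α`;
`2α−α′+2 = −(α−1)′·(α+1)`; and `2α+2α′−2a−1 = −(α−1)/(α+1)`. In particular each of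
these elements is the product of a conjugate of `α−1` with a unit of `ℤ[α]`. -/
theorem stmt_15 (a : ℕ) (ha : 1 ≤ a)
    (hirr : Irreducible (X ^ 3 - C (a : ℚ) * X ^ 2 - C ((a : ℚ) + 3) * X - C 1))
    (K : Type*) [Field K] [NumberField K]
    (α : K) (hα : α ^ 3 - (a : K) * α ^ 2 - ((a : K) + 3) * α - 1 = 0)
    (hgen : IntermediateField.adjoin ℚ {α} = ⊤)
    (σ : K ≃ₐ[ℚ] K) (hσ : σ α = -(α + 1) / α) :
    α + 2 = -(σ (σ (α - 1))) * (α + 1) ∧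
    α - ((a : K) + 1) = -(σ (α - 1)) / (α + 1) ∧
    2 * α + 1 = -(σ (α - 1)) * α ∧
    α + σ α - (a : K) + 1 = -(σ (σ (α - 1))) ∧
    α + σ α - (a : K) - 2 = σ (α - 1) * α / (α + 1) ∧
    α + σ α + 1 = (α - 1) * (α + 1) / α ∧
    2 * α - σ α + 2 = -(σ (α - 1)) * (α + 1) ∧
    2 * α + 2 * σ α - 2 * (a : K) - 1 = -(α - 1) / (α + 1) := by
  have h0 : α ≠ 0 := by
    rintro rfl
    norm_num at hα
  have h1 : α + 1 ≠ 0 := by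
    intro h
    have h2 : α = -1 := by linear_combination h
    rw [h2] at hα
    ring_nf at hα
    norm_num at hα
  have hss : σ (σ α) = -1 / (α + 1) := by
    have h2 : σ (σ α) = -(σ α + 1) / σ α := by
      conv_lhs => rw [hσ]
      simp
    rw [h2, hσ]
    have h3 : -(α + 1) ≠ 0 := neg_ne_zero.mpr h1
    field_simp
    ring
  have hsum : (a : K) = α + σ α - 1 / (α + 1) := by
    rw [hσ]
    field_simp
    linear_combination -hα
  have e1 : σ (α - 1) = σ α - 1 := by simp
  have e2 : σ (σ (α - 1)) = σ (σ α) - 1 := by simp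
  rw [e2, e1, hss, hsum, hσ]
  refine ⟨?_, ?_, ?_, ?_, ?_, ?_, ?_, ?_⟩ <;> field_simp <;> ring
end

section
/- Let a ≥ 1 be a natural number, α the smallest real root of f_a = x³ − a·x² − (a+3)·x − 1, and K = ℚ(α). Then for every nonzero γ ∈ ℤ[α], either |N_{K/ℚ}(γ)| ≥ 2a+3, or γ is associated to a rational integer, i.e. γ = n·η for some n ∈ ℤ and some unit η of the ring ℤ[α]. -/
/-- norm form -/
def nf16 (a x y z : ℤ) : ℤ :=
  x^3 + a*x^2*y + (a^2+2*a+6)*x^2*z - (a+3)*x*y^2 - (a^2+3*a+3)*x*y*z + (a^2+4*a+9)*x*z^2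
    + y^3 + a*y^2*z - (a+3)*y*z^2 + z^3

/-- the cubic form in the second cone -/
def F16 (a p q r : ℤ) : ℤ :=
  p^3 + q^3 + r^3 + (a^2+2*a+6)*(p^2*q+p*r^2+q^2*r) + (a^2+4*a+9)*(p^2*r+p*q^2+q*r^2)
   + (a^4+6*a^3+21*a^2+36*a+33)*p*q*r

def G16 (a p q r : ℤ) : ℤ :=
  p^3 + q^3 + r^3 + (a^2+2*a+6)*(p^2*q+p*r^2+q^2*r) + (a^2+4*a+9)*(p^2*r+p*q^2+q*r^2)
   + (2*a^2+6*a+24)*p*q*r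

lemma nf16_F (a x y z : ℤ) : (a^2+3*a+3)^3 * nf16 a x y z =
    F16 a (x*(a^2+3*a+3)-(a+1)*y) (z*(a^2+3*a+3)+(a+2)*y) (-y) := by
  unfold nf16 F16; ring

lemma nf16_G (a x y z : ℤ) : 8 * nf16 a x y z = G16 a (2*x-y) (2*z-y) y := by
  unfold nf16 G16; ring

lemma F16_mono (a : ℤ) (ha : 1 ≤ a) {p q r p' q' r' : ℤ} (hp : 0 ≤ p) (hq : 0 ≤ q) (hr : 0 ≤ r)
    (hp' : p ≤ p') (hq' : q ≤ q') (hr' : r ≤ r') : F16 a p q r ≤ F16 a p' q' r' := by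
  unfold F16
  have : 0 ≤ a := by omega
  have p0 : 0 ≤ p' := by omega
  have q0 : 0 ≤ q' := by omega
  have r0 : 0 ≤ r' := by omega
  gcongr

lemma G16_mono (a : ℤ) (ha : 1 ≤ a) {p q r p' q' r' : ℤ} (hp : 0 ≤ p) (hq : 0 ≤ q) (hr : 0 ≤ r)
    (hp' : p ≤ p') (hq' : q ≤ q') (hr' : r ≤ r') : G16 a p q r ≤ G16 a p' q' r' := by
  unfold G16
  have : 0 ≤ a := by omega
  have p0 : 0 ≤ p' := by omega
  have q0 : 0 ≤ q' := by omega
  have r0 : 0 ≤ r' := by omega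
  gcongr

lemma cone2_k2 (a : ℤ) (ha : 1 ≤ a) (p q r : ℤ) (hp : 0 ≤ p) (hq : 0 ≤ q) (hr : 0 ≤ r) :
    (2*a+3) * (p+q+r)^3 ≤ F16 a (q+r) (p+r) (p+q) := by
  have h0 : 0 ≤ a := by omega
  rw [← sub_nonneg]
  have : F16 a (q+r) (p+r) (p+q) - (2*a+3) * (p+q+r)^3 =
    (2*a^2+4*a+14)*(p^3+q^3+r^3) + (a^4+6*a^3+26*a^2+46*a+66)*(p^2*q+p*r^2+q^2*r)
    + (a^4+6*a^3+26*a^2+44*a+63)*(p^2*r+p*q^2+q*r^2)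
    + (2*a^4+12*a^3+54*a^2+96*a+138)*p*q*r := by
    unfold F16; ring
  rw [this]; positivity

lemma cone2_k1 (a : ℤ) (ha : 1 ≤ a) (p q r : ℤ) (hp : 0 ≤ p) (hq : 0 ≤ q) (hr : 0 ≤ r) :
    (2*a+3) * (p+q+r)^3 ≤ nf16 a (-a*r) (-p-(a+1)*q-(a+1)^2*r) (p+q+(a+1)*r) := by
  have h0 : 0 ≤ a := by omega
  rw [← sub_nonneg]
  have : nf16 a (-a*r) (-p-(a+1)*q-(a+1)^2*r) (p+q+(a+1)*r) - (2*a+3) * (p+q+r)^3 =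
    3*a^2*(p^2*q+p*r^2+q^2*r) + (a^3+3*a^2)*(p^2*r+p*q^2+q*r^2)
    + (a^4+3*a^3+9*a^2)*p*q*r := by
    unfold nf16; ring
  rw [this]; positivity

lemma cone2 (a : ℤ) (ha : 1 ≤ a) (k : ℕ) : ∀ x y z : ℤ, x + z = k → y < 0 →
    0 < x*(a^2+3*a+3)-(a+1)*y → 0 < z*(a^2+3*a+3)+(a+2)*y → 2*a+3 ≤ nf16 a x y z := by
  have hD : 0 < a^2+3*a+3 := by positivity
  have hD3 : 0 < (a^2+3*a+3)^3 := by positivity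
  induction k with
  | zero =>
    intro x y z hk hy h1 h2
    have : x = -z := by push_cast at hk; omega
    subst this
    nlinarith
  | succ k ih =>
    intro x y z hk hy h1 h2
    have key : ∀ x' y' z' : ℤ, x' + z' = k → 
        0 < x'*(a^2+3*a+3)-(a+1)*y' → 0 < z'*(a^2+3*a+3)+(a+2)*y' → y' < 0 →
        x'*(a^2+3*a+3)-(a+1)*y' ≤ x*(a^2+3*a+3)-(a+1)*y →
        z'*(a^2+3*a+3)+(a+2)*y' ≤ z*(a^2+3*a+3)+(a+2)*y → y ≤ y' → 2*a+3 ≤ nf16 a x y z := by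
      intro x' y' z' hk' h1' h2' h3' i1 i2 i3
      refine (ih x' y' z' hk' h3' h1' h2').trans ?_
      have := F16_mono a ha h1'.le h2'.le (neg_pos.2 h3').le i1 i2 (neg_le_neg i3)
      rw [← nf16_F, ← nf16_F] at this
      exact le_of_mul_le_mul_left this hD3
    push_cast at hk
    by_cases c1 : a^2+3*a+3 < x*(a^2+3*a+3)-(a+1)*y
    · exact key (x-1) y z (by omega) (by linarith) h2 hy (by linarith) le_rfl le_rfl
    by_cases c2 : a^2+3*a+3 < z*(a^2+3*a+3)+(a+2)*y
    · exact key x y (z-1) (by omega) h1 (by linarith) hy le_rfl (by linarith) le_rfl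
    by_cases c3 : a^2+3*a+3 < -y
    · refine key (x+(a+1)) (y+(a^2+3*a+3)) (z-(a+2)) (by omega) ?_ ?_ (by linarith) ?_ ?_ (by linarith)
      all_goals nlinarith
    push Not at c1 c2 c3
    have hsum : (x*(a^2+3*a+3)-(a+1)*y) + (z*(a^2+3*a+3)+(a+2)*y) + (-y)
        = (k+1)*(a^2+3*a+3) := by rw [← hk]; ring
    have hk3 : (k:ℤ) + 1 ≤ 3 := by
      by_contra hc
      push Not at hc
      nlinarith
    have hk3' : k ≤ 2 := by omega
    interval_cases k
    · -- k = 1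
      have hx : x = 1 - z := by push_cast at hk; omega
      obtain ⟨v, rfl⟩ : ∃ v, z = v + 1 := ⟨z-1, by ring⟩
      obtain ⟨w, rfl⟩ : ∃ w, y = -w := ⟨-y, by ring⟩
      have hx' : x = -v := by omega
      subst hx'
      have hv : 0 ≤ v := by
        by_contra hc
        push Not at hc
        nlinarith
      have hw : v*(a+2)+1 ≤ w := by
        by_contra hc
        push Not at hc
        nlinarith
      have hv2 : v < a + 1 := by
        by_contra hc
        push Not at hc
        nlinarith
      have hw2 : w ≤ (v+1)*(a+1) := by
        by_contra hc
        push Not at hc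
        nlinarith
      have := cone2_k1 a ha (a+1-w+(a+1)*v) (w-1-(a+2)*v) v (by linarith) (by linarith) hv
      have e1 : nf16 a (-a*v) (-(a+1-w+(a+1)*v)-(a+1)*(w-1-(a+2)*v)-(a+1)^2*v)
          ((a+1-w+(a+1)*v)+(w-1-(a+2)*v)+(a+1)*v) = a^3 * nf16 a (-v) (-w) (v+1) := by
        unfold nf16; ring
      have e2 : (a+1-w+(a+1)*v)+(w-1-(a+2)*v)+v = a := by ring
      rw [e1, e2, mul_comm] at this
      exact le_of_mul_le_mul_left this (by positivity)
    · have := cone2_k2 a ha (a^2+3*a+3-(x*(a^2+3*a+3)-(a+1)*y)) (a^2+3*a+3-(z*(a^2+3*a+3)+(a+2)*y))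
        (a^2+3*a+3-(-y)) (by linarith) (by linarith) (by linarith)
      have hs : x = 2 - z := by push_cast at hk; omega
      have e1 : (a^2+3*a+3-(z*(a^2+3*a+3)+(a+2)*y)) + (a^2+3*a+3-(-y)) = x*(a^2+3*a+3)-(a+1)*y := by
        rw [hs]; ring
      have e2 : (a^2+3*a+3-(x*(a^2+3*a+3)-(a+1)*y)) + (a^2+3*a+3-(-y)) = z*(a^2+3*a+3)+(a+2)*y := by
        rw [hs]; ring
      have e3 : (a^2+3*a+3-(x*(a^2+3*a+3)-(a+1)*y)) + (a^2+3*a+3-(z*(a^2+3*a+3)+(a+2)*y)) = -y := by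
        rw [hs]; ring
      have e4 : (a^2+3*a+3-(x*(a^2+3*a+3)-(a+1)*y)) + (a^2+3*a+3-(z*(a^2+3*a+3)+(a+2)*y))
         + (a^2+3*a+3-(-y)) = a^2+3*a+3 := by rw [hs]; ring
      rw [e4, e1, e2, e3, ← nf16_F, mul_comm] at this
      exact le_of_mul_le_mul_left this hD3
    · have t1 : x*(a^2+3*a+3)-(a+1)*y = a^2+3*a+3 := by push_cast at hsum; linarith
      have t2 : z*(a^2+3*a+3)+(a+2)*y = a^2+3*a+3 := by push_cast at hsum; linarith
      have t3 : -y = a^2+3*a+3 := by push_cast at hsum; linarith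
      have := nf16_F a x y z
      rw [t1, t2, t3] at this
      have e : F16 a (a^2+3*a+3) (a^2+3*a+3) (a^2+3*a+3) = (a^2+3*a+3)^3 * F16 a 1 1 1 := by
        unfold F16; ring
      rw [e] at this
      rw [mul_left_cancel₀ hD3.ne' this]
      unfold F16
      nlinarith [pow_pos (show 0 < a by omega) 3, pow_pos (show 0 < a by omega) 4]

lemma core (a : ℤ) (ha : 1 ≤ a) (P : ℤ → ℤ → ℤ → Prop)
    (hN : ∀ x y z, 2*a+3 ≤ nf16 a x y z → P x y z)
    (hn : ∀ n, P n 0 0)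
    (hneg : ∀ x y z, P (-x) (-y) (-z) → P x y z)
    (hA : ∀ x y z, P z (x+(a+3)*z) (y+a*z) ↔ P x y z)
    (hB : ∀ x y z, P (x+z) (x+y+(a+3)*z) (y+(a+1)*z) ↔ P x y z)
    (r1 r2 r3 : ℝ) (s1 : r1 + r2 + r3 = a) (s2 : r1*r2+r1*r3+r2*r3 = -(a+3)) (s3 : r1*r2*r3 = 1)
    (h1 : r1 < -1) (h2 : -1 < r2) (h2' : r2 < 0) (h3 : 0 < r3) :
    ∀ x y z : ℤ, nf16 a x y z ≠ 0 → P x y z := by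
  have f1 : r1^3 = a*r1^2+(a+3)*r1+1 := by
    linear_combination (r1^2) * s1 - r1 * s2 + s3
  have f2 : r2^3 = a*r2^2+(a+3)*r2+1 := by
    linear_combination (r2^2) * s1 - r2 * s2 + s3
  have f3 : r3^3 = a*r3^2+(a+3)*r3+1 := by
    linear_combination (r3^2) * s1 - r3 * s2 + s3
  have hA2 : ∀ x y z, P (y+a*z) ((a+3)*y+(a^2+3*a+1)*z) (x+a*y+(a^2+a+3)*z) ↔ P x y z := by
    intro x y z
    refine Iff.trans ?_ ((hA z (x+(a+3)*z) (y+a*z)).trans (hA x y z))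
    apply iff_of_eq
    congr 1 <;> ring
  have hB2 : ∀ x y z, P (x+y+(a+2)*z) (2*x+(a+4)*y+(a^2+5*a+7)*z) (x+(a+2)*y+(a^2+3*a+4)*z)
      ↔ P x y z := by
    intro x y z
    refine Iff.trans ?_ ((hB (x+z) (x+y+(a+3)*z) (y+(a+1)*z)).trans (hB x y z))
    apply iff_of_eq
    congr 1 <;> ring
  -- the first cone
  have cone1 : ∀ x y z : ℤ, 0 ≤ y → y ≤ 2*x → y ≤ 2*z → P x y z := by
    intro x y z hy hx hz
    have two : ∀ p q r : ℤ, 0 ≤ p → 0 ≤ q → 0 ≤ r → p ≤ 2*x-y → q ≤ 2*z-y → r ≤ y →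
        8*(2*a+3) ≤ G16 a p q r → P x y z := by
      intro p q r hp hq hr ip iq ir h
      apply hN
      have := G16_mono a ha hp hq hr ip iq ir
      rw [← nf16_G] at this
      linarith
    by_cases cA : 2*x - y = 0
    · obtain ⟨m, rfl⟩ : ∃ m, y = 2*m := ⟨x, by omega⟩
      obtain rfl : x = m := by omega
      by_cases cB : z = x
      · subst cB
        have := (hB z z 0).2 ((hB z 0 0).2 (hn z) |> fun h => by simpa using h)
        convert this using 1 <;> ring
      by_cases cC : x = 0
      · subst cC
        have := (hA 0 z 0).2 ((hA z 0 0).2 (hn z) |> fun h => by simpa using h)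
        simpa using this
      · exact two 0 2 2 (by omega) (by omega) (by omega) (by omega) (by omega) (by omega)
          (by unfold G16; nlinarith)
    by_cases cB : 2*z - y = 0
    · obtain ⟨m, rfl⟩ : ∃ m, y = 2*m := ⟨z, by omega⟩
      obtain rfl : z = m := by omega
      by_cases cC : z = 0
      · subst cC; simpa using hn x
      · exact two 2 0 2 (by omega) (by omega) (by omega) (by omega) (by omega) (by omega)
          (by unfold G16; nlinarith)
    by_cases cC : y = 0
    · exact two 2 2 0 (by omega) (by omega) (by omega) (by omega) (by omega) (by omega)
          (by unfold G16; nlinarith)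
    · exact two 1 1 1 (by omega) (by omega) (by omega) (by omega) (by omega) (by omega)
          (by unfold G16; nlinarith)
  -- totally positive elements
  have pos : ∀ x y z : ℤ, 0 < x + y*r1 + z*r1^2 → 0 < x + y*r2 + z*r2^2 → 0 < x + y*r3 + z*r3^2 →
      0 < x + z := by
    intro x y z g1 g2 g3
    have id : ((x:ℝ)+z) * ((r2-r1)*(r3-r1)*(r3-r2)) =
       (x + y*r1 + z*r1^2)*((1+r2*r3)*(r3-r2)) + (x + y*r2 + z*r2^2)*(-(1+r1*r3)*(r3-r1))
       + (x + y*r3 + z*r3^2)*((1+r1*r2)*(r2-r1)) := by ring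
    have k1 : 0 < 1 + r2*r3 := by nlinarith
    have k2 : 0 < -(1 + r1*r3) := by nlinarith
    have k3 : 0 < 1 + r1*r2 := by nlinarith
    have d1 : 0 < r2 - r1 := by linarith
    have d2 : 0 < r3 - r1 := by linarith
    have d3 : 0 < r3 - r2 := by linarith
    have : 0 < ((x:ℝ)+z) * ((r2-r1)*(r3-r1)*(r3-r2)) := by rw [id]; positivity
    have := pos_of_mul_pos_left this (by positivity)
    exact_mod_cast this
  have desc : ∀ k : ℕ, ∀ x y z : ℤ, x + z = k → 0 < x + y*r1 + z*r1^2 → 0 < x + y*r2 + z*r2^2 →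
      0 < x + y*r3 + z*r3^2 → P x y z := by
    intro k
    induction k using Nat.strong_induction_on with
    | _ k ih =>
    intro x y z hk g1 g2 g3
    have step : ∀ x' y' z' : ℤ, (P x' y' z' → P x y z) →
        (∀ r : ℝ, r ≠ 0 → 1 + r ≠ 0 → r^3 = a*r^2+(a+3)*r+1 → ∃ t u : ℝ, t ≠ 0 ∧ u ≠ 0 ∧
         u^2 * ((x:ℝ) + y*r + z*r^2) = t^2 * (x' + y'*r + z'*r^2)) → ¬ x + z ≤ x' + z' →
         P x y z := by
      intro x' y' z' hP hr hlt
      apply hP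
      have aux : ∀ r : ℝ, r ≠ 0 → 1 + r ≠ 0 → r^3 = a*r^2+(a+3)*r+1 → 0 < (x:ℝ) + y*r + z*r^2 →
          0 < (x':ℝ) + y'*r + z'*r^2 := by
        intro r h h' h'' h0
        obtain ⟨t, u, ht, hu, e⟩ := hr r h h' h''
        have : 0 < u^2 * ((x:ℝ) + y*r + z*r^2) := by positivity
        rw [e] at this
        exact pos_of_mul_pos_right this (by positivity)
      have g1' := aux r1 (by linarith) (by linarith) f1 g1
      have g2' := aux r2 (by linarith) (by linarith) f2 g2
      have g3' := aux r3 (by linarith) (by linarith) f3 g3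
      have hp := pos x' y' z' g1' g2' g3'
      exact ih (x'+z').toNat (by omega) x' y' z' (by omega) g1' g2' g3'
    by_cases cBi : x + z ≤ ((2-a)*x+a*y-(a+1)*z) + (a*x-(a+1)*y+(a+2)*z)
    swap
    · refine step _ (-(a^2+a+1)*x+(a^2+2*a+2)*y-(a^2+3*a+3)*z) _ ?_ ?_ cBi
      · intro h
        rw [← hB2] at h
        convert h using 1 <;> ring
      · intro r h h' hf
        refine ⟨1+r, 1, h', one_ne_zero, ?_⟩
        push_cast
        linear_combination (-((a*x-(a+1)*y+(a+2)*z)*r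
          + ((-(a^2+a+1)*x+(a^2+2*a+2)*y-(a^2+3*a+3)*z) + (a+2)*(a*x-(a+1)*y+(a+2)*z))) : ℝ) * hf
    by_cases cAB : x + z ≤ (-(a+1)*x+(a+2)*y-(a+3)*z) + ((a+2)*x-(a+3)*y+(a+5)*z)
    swap
    · refine step _ (-(a^2+3*a+3)*x+(a^2+4*a+5)*y-(a^2+5*a+7)*z) _ ?_ ?_ cAB
      · intro h
        rw [← hB2] at h
        rw [← hA2]
        convert h using 1 <;> ring
      · intro r h h' hf
        refine ⟨1+r, r, h', h, ?_⟩
        push_cast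
        linear_combination ((z*r+y+a*z)-(((a+2)*x-(a+3)*y+(a+5)*z)*r
          + ((-(a^2+3*a+3)*x+(a^2+4*a+5)*y-(a^2+5*a+7)*z) + (a+2)*((a+2)*x-(a+3)*y+(a+5)*z))) : ℝ) * hf
    by_cases cBA : x + z ≤ ((a^2+3*a+4)*x-(a+1)*y+z) + (-(a+1)*x+y+z)
    swap
    · refine step _ ((a^2+a+1)*x-(a-1)*y+2*z) _ ?_ ?_ cBA
      · intro h
        rw [← hA2] at h
        rw [← hB2]
        convert h using 1 <;> ring
      · intro r h h' hf
        refine ⟨r, 1+r, h, h', ?_⟩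
        push_cast
        linear_combination ((z*r+y+(a+2)*z)-((-(a+1)*x+y+z)*r
          + (((a^2+a+1)*x-(a-1)*y+2*z) + a*(-(a+1)*x+y+z))) : ℝ) * hf
    by_cases cA : x + z ≤ (y+a*z) + (x+a*y+(a^2+a+3)*z)
    swap
    · refine step _ ((a+3)*y+(a^2+3*a+1)*z) _ ?_ ?_ cA
      · intro h
        rw [← hA2]
        convert h using 1 <;> ring
      · intro r h h' hf
        refine ⟨1, r, one_ne_zero, h, ?_⟩
        push_cast
        linear_combination (z*r+y+a*z : ℝ) * hf
    by_cases cB : x + z ≤ (x+y+(a+2)*z) + (x+(a+2)*y+(a^2+3*a+4)*z)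
    swap
    · refine step _ (2*x+(a+4)*y+(a^2+5*a+7)*z) _ ?_ ?_ cB
      · intro h
        rw [← hB2]
        convert h using 1 <;> ring
      · intro r h h' hf
        refine ⟨1, 1+r, one_ne_zero, h', ?_⟩
        push_cast
        linear_combination (z*r+y+(a+2)*z : ℝ) * hf
    by_cases cAi : x + z ≤ ((a^2+5*a+9)*x-(a+3)*y+z) + (-(a+3)*x+y)
    swap
    · refine step _ ((a^2+3*a+1)*x-a*y) _ ?_ ?_ cAi
      · intro h
        rw [← hA2] at h
        convert h using 1 <;> ring
      · intro r h h' hf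
        refine ⟨r, 1, h, one_ne_zero, ?_⟩
        push_cast
        linear_combination (-((-(a+3)*x+y)*r + ((a^2+3*a+1)*x-a*y) + a*(-(a+3)*x+y)) : ℝ) * hf
    by_cases hy : 0 ≤ y
    · exact cone1 x y z hy (by linarith) (by linarith)
    push Not at hy
    by_cases hT1 : 0 < x*(a^2+3*a+3)-(a+1)*y
    swap
    · have h := cone1 ((a^2+3*a+4)*x-(a+1)*y+z) ((a^2+a+1)*x-(a-1)*y+2*z) (-(a+1)*x+y+z)
        (by linarith) (by linarith) (by linarith)
      rw [← hA2] at h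
      rw [← hB2]
      convert h using 1 <;> ring
    by_cases hT2 : 0 < z*(a^2+3*a+3)+(a+2)*y
    swap
    · have h := cone1 (x+y+(a+2)*z) (2*x+(a+4)*y+(a^2+5*a+7)*z) (x+(a+2)*y+(a^2+3*a+4)*z)
        (by linarith) (by linarith) (by linarith)
      rw [← hB2]
      convert h using 1 <;> ring
    exact hN _ _ _ (cone2 a ha k x y z hk hy hT1 hT2)
  intro x y z hne
  have hprod : ((nf16 a x y z : ℤ) : ℝ) =
      (x + y*r1 + z*r1^2) * (x + y*r2 + z*r2^2) * (x + y*r3 + z*r3^2) := by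
    have e : ((x:ℝ) + y*r1 + z*r1^2) * (x + y*r2 + z*r2^2) * (x + y*r3 + z*r3^2) =
      x^3 + x^2*y*(r1+r2+r3) + x^2*z*((r1+r2+r3)^2-2*(r1*r2+r1*r3+r2*r3))
      + x*y^2*(r1*r2+r1*r3+r2*r3) + x*y*z*((r1+r2+r3)*(r1*r2+r1*r3+r2*r3)-3*(r1*r2*r3))
      + x*z^2*((r1*r2+r1*r3+r2*r3)^2-2*(r1+r2+r3)*(r1*r2*r3)) + y^3*(r1*r2*r3)
      + y^2*z*((r1+r2+r3)*(r1*r2*r3)) + y*z^2*((r1*r2+r1*r3+r2*r3)*(r1*r2*r3))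
      + z^3*(r1*r2*r3)^2 := by ring
    rw [e, s1, s2, s3]
    unfold nf16
    push_cast
    ring
  have L0 : ∀ x y z : ℤ, 0 < x + y*r1 + z*r1^2 → 0 < x + y*r2 + z*r2^2 →
      0 < x + y*r3 + z*r3^2 → P x y z := by
    intro x y z g1 g2 g3
    have := pos x y z g1 g2 g3
    exact desc (x+z).toNat x y z (by omega) g1 g2 g3
  have L1 : ∀ x y z : ℤ, x + y*r1 + z*r1^2 ≠ 0 → 0 < x + y*r2 + z*r2^2 →
      0 < x + y*r3 + z*r3^2 → P x y z := by
    intro x y z g1 g2 g3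
    rcases lt_or_gt_of_ne g1 with g1 | g1
    swap
    · exact L0 x y z g1 g2 g3
    rw [← hB]
    have aux : ∀ r : ℝ, r^3 = a*r^2+(a+3)*r+1 → 0 < (1+r) * (x+y*r+z*r^2) →
        0 < ((x+z : ℤ):ℝ) + (x+y+(a+3)*z : ℤ) * r + (y+(a+1)*z : ℤ) * r^2 := by
      intro r hf h
      convert h using 1
      push_cast
      linear_combination -(z:ℝ) * hf
    exact L0 _ _ _ (aux r1 f1 (mul_pos_of_neg_of_neg (by linarith) g1))
      (aux r2 f2 (mul_pos (by linarith) g2)) (aux r3 f3 (mul_pos (by linarith) g3))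
  have L2 : ∀ x y z : ℤ, x + y*r1 + z*r1^2 ≠ 0 → x + y*r2 + z*r2^2 ≠ 0 →
      0 < x + y*r3 + z*r3^2 → P x y z := by
    intro x y z g1 g2 g3
    rcases lt_or_gt_of_ne g2 with g2 | g2
    swap
    · exact L1 x y z g1 g2 g3
    rw [← hA]
    have aux : ∀ r : ℝ, r^3 = a*r^2+(a+3)*r+1 →
        ((z : ℤ):ℝ) + (x+(a+3)*z : ℤ) * r + (y+a*z : ℤ) * r^2 = r * (x+y*r+z*r^2) := by
      intro r hf
      push_cast
      linear_combination -(z:ℝ) * hf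
    refine L1 _ _ _ ?_ ?_ ?_
    · rw [aux r1 f1]; exact mul_ne_zero (by linarith) g1
    · rw [aux r2 f2]; exact mul_pos_of_neg_of_neg h2' g2
    · rw [aux r3 f3]; exact mul_pos h3 g3
  have hne' : ((nf16 a x y z : ℤ) : ℝ) ≠ 0 := by exact_mod_cast hne
  rw [hprod] at hne'
  have g3 := right_ne_zero_of_mul hne'
  have g12 := left_ne_zero_of_mul hne'
  have g1 := left_ne_zero_of_mul g12
  have g2 := right_ne_zero_of_mul g12
  rcases lt_or_gt_of_ne g3 with g3 | g3
  swap
  · exact L2 x y z g1 g2 g3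
  apply hneg
  have aux : ∀ r : ℝ, ((-x : ℤ):ℝ) + (-y : ℤ) * r + (-z : ℤ) * r^2 = - (x+y*r+z*r^2) := by
    intro r; push_cast; ring
  refine L2 _ _ _ ?_ ?_ ?_
  · rw [aux]; exact neg_ne_zero.2 g1
  · rw [aux]; exact neg_ne_zero.2 g2
  · rw [aux]; linarith

open Polynomial in
/-- Let `a ≥ 1`, `α` the smallest real root of the (irreducible)
polynomial `f_a = x³ − a·x² − (a+3)·x − 1`, and `K = ℚ(α)`. Then for every nonzero
`γ ∈ ℤ[α]`, either `|N_{K/ℚ}(γ)| ≥ 2a+3`, or `γ` is associated to a rational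
integer, i.e. `γ = n·η` for some `n ∈ ℤ` and some unit `η` of the ring `ℤ[α]`. -/
theorem stmt_16 (a : ℕ) (ha : 1 ≤ a)
    (hirr : Irreducible (X ^ 3 - C (a : ℚ) * X ^ 2 - C ((a : ℚ) + 3) * X - C 1))
    (α : ℝ) (hα : α ^ 3 - (a : ℝ) * α ^ 2 - ((a : ℝ) + 3) * α - 1 = 0)
    (hmin : ∀ x : ℝ, x ^ 3 - (a : ℝ) * x ^ 2 - ((a : ℝ) + 3) * x - 1 = 0 → α ≤ x)
    (γ : cubicField α) (hγmem : γ ∈ intAdjoin α) (hγ0 : γ ≠ 0) :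
    2 * (a : ℚ) + 3 ≤ |Algebra.norm ℚ γ| ∨
    ∃ (n : ℤ) (η : (intAdjoin α)ˣ),
      γ = (n : cubicField α) * ((η : intAdjoin α) : cubicField α) := by
  have hc : (cubicGen α)^3 = (a : cubicField α) * (cubicGen α)^2
      + ((a : cubicField α)+3) * cubicGen α + 1 := by
    apply Subtype.ext
    simp only [cubicGen]
    have h3 : ((3 : cubicField α) : ℝ) = 3 := rfl
    push_cast
    linear_combination hα - α * h3
  set c := cubicGen α with hcdef
  have hmonic : (X ^ 3 - C (a : ℚ) * X ^ 2 - C ((a : ℚ) + 3) * X - C 1).Monic := by monicity!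
  have hdeg : (X ^ 3 - C (a : ℚ) * X ^ 2 - C ((a : ℚ) + 3) * X - C 1).natDegree = 3 := by
    compute_degree!
  have hroot : aeval α (X ^ 3 - C (a : ℚ) * X ^ 2 - C ((a : ℚ) + 3) * X - C 1) = 0 := by
    simp only [map_sub, map_mul, map_pow, aeval_X, aeval_C, map_add, map_natCast, map_one]
    simpa using hα
  have hmp := minpoly.eq_of_irreducible_of_monic hirr hroot hmonic
  have hint : IsIntegral ℚ α := ⟨_, hmonic, by simpa [aeval_def] using hroot⟩
  haveI hfin : Module.Finite ℚ (cubicField α) := IntermediateField.adjoin.finiteDimensional hint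
  -- norm formula
  have hnorm : ∀ x y z : ℤ, Algebra.norm ℚ ((x : cubicField α) + y * c + z * c^2)
      = (nf16 a x y z : ℤ) := by
    intro x y z
    let pb := IntermediateField.adjoin.powerBasis hint
    have hdim : pb.dim = 3 := by
      rw [IntermediateField.adjoin.powerBasis_dim, ← hmp, hdeg]
    let b := pb.basis.reindex (finCongr hdim)
    have hb : ∀ i, b i = c ^ (i : ℕ) := by
      intro i
      simp [b, pb, hcdef, cubicGen, IntermediateField.AdjoinSimple.gen]
    let M : Matrix (Fin 3) (Fin 3) ℚ :=
      !![(x:ℚ), z, y + a*z; y, x+(a+3)*z, z + (a+3)*(y+a*z); z, y+a*z, x+(a+3)*z+a*(y+a*z)]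
    have hM : Algebra.leftMulMatrix b ((x : cubicField α) + y * c + z * c^2) = M := by
      ext i j
      rw [Algebra.leftMulMatrix_eq_repr_mul]
      have : ((x : cubicField α) + y * c + z * c^2) * b j = ∑ i, M i j • b i := by
        simp only [Fin.sum_univ_three, hb, Algebra.smul_def]
        fin_cases j
        · simp [M]
        · simp [M]
          linear_combination (z : cubicField α) * hc
        · simp [M]
          linear_combination ((z : cubicField α) * c + y + a * z) * hc
      rw [this, Module.Basis.repr_sum_self]
    refine (Algebra.norm_eq_matrix_det b _).trans ?_
    rw [hM, Matrix.det_fin_three]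
    simp [M, nf16]
    ring
  have hcmem : c ∈ intAdjoin α := Algebra.subset_adjoin rfl
  -- coordinates
  have hcoord : ∀ g ∈ intAdjoin α, ∃ x y z : ℤ, g = (x : cubicField α) + y * c + z * c^2 := by
    intro g hg
    induction hg using Algebra.adjoin_induction with
    | mem g h => exact ⟨0, 1, 0, by rw [Set.mem_singleton_iff.1 h]; simp [hcdef]⟩
    | algebraMap n => exact ⟨n, 0, 0, by simp⟩
    | add g h _ _ i1 i2 =>
      obtain ⟨x, y, z, rfl⟩ := i1
      obtain ⟨x', y', z', rfl⟩ := i2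
      exact ⟨x+x', y+y', z+z', by push_cast; ring⟩
    | mul g h _ _ i1 i2 =>
      obtain ⟨x, y, z, rfl⟩ := i1
      obtain ⟨x', y', z', rfl⟩ := i2
      refine ⟨x*x' + (y*z'+z*y') + z*z'*a,
        x*y'+y*x' + (y*z'+z*y')*(a+3) + z*z'*(a*(a+3)+1),
        x*z'+y*y'+z*x' + (y*z'+z*y')*a + z*z'*(a^2+a+3), ?_⟩
      push_cast
      linear_combination ((y*z'+z*y') + z*z'*(c+a) : cubicField α) * hc
  let Q : cubicField α → Prop := fun g => 2 * (a : ℚ) + 3 ≤ |Algebra.norm ℚ g| ∨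
    ∃ (n : ℤ) (η : (intAdjoin α)ˣ),
      g = (n : cubicField α) * ((η : intAdjoin α) : cubicField α)
  have hQu : ∀ u : (intAdjoin α)ˣ, |Algebra.norm ℚ ((u : intAdjoin α) : cubicField α)| = 1 →
      ∀ g, Q (((u : intAdjoin α) : cubicField α) * g) ↔ Q g := by
    intro u hu g
    have huinv : (((u⁻¹ : (intAdjoin α)ˣ) : intAdjoin α) : cubicField α)
        * ((u : intAdjoin α) : cubicField α) = 1 := by
      exact congrArg (Subtype.val) u.inv_mul
    simp only [Q, map_mul, abs_mul, hu, one_mul]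
    apply or_congr_right
    constructor
    · rintro ⟨n, η, h⟩
      refine ⟨n, u⁻¹ * η, ?_⟩
      push_cast
      linear_combination (((u⁻¹ : (intAdjoin α)ˣ) : intAdjoin α) : cubicField α) * h - g * huinv
    · rintro ⟨n, η, h⟩
      refine ⟨n, u * η, ?_⟩
      rw [h]
      push_cast
      ring
  let cA : intAdjoin α := ⟨c, hcmem⟩
  have hcA : cA^3 = (a : intAdjoin α) * cA^2 + ((a : intAdjoin α)+3) * cA + 1 := by
    apply Subtype.ext
    push_cast
    exact hc
  let uA : (intAdjoin α)ˣ := Units.mkOfMulEqOne cA (cA^2 - a * cA - (a+3))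
    (by linear_combination hcA)
  let uB : (intAdjoin α)ˣ := Units.mkOfMulEqOne (1 + cA) (2 + (a+1) * cA - cA^2)
    (by linear_combination -hcA)
  have huA : ((uA : intAdjoin α) : cubicField α) = c := rfl
  have huB : ((uB : intAdjoin α) : cubicField α) = 1 + c := rfl
  have nA : |Algebra.norm ℚ ((uA : intAdjoin α) : cubicField α)| = 1 := by
    have := hnorm 0 1 0
    rw [huA]
    simp [nf16] at this
    simp [this]
  have nB : |Algebra.norm ℚ ((uB : intAdjoin α) : cubicField α)| = 1 := by
    have := hnorm 1 1 0
    rw [huB]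
    have e : nf16 a 1 1 0 = -1 := by unfold nf16; ring
    rw [e] at this
    simp at this
    simp [this]
  have nneg : |Algebra.norm ℚ (((-1 : (intAdjoin α)ˣ) : intAdjoin α) : cubicField α)| = 1 := by
    have := hnorm (-1) 0 0
    have e : nf16 a (-1) 0 0 = -1 := by unfold nf16; ring
    rw [e] at this
    simp at this
    simp [this]
  have hα1 : α < -1 := by
    have hcont : ContinuousOn (fun x : ℝ => x ^ 3 - (a : ℝ) * x ^ 2 - ((a : ℝ) + 3) * x - 1)
        (Set.Icc (-2) (-1)) := by fun_prop
    have hmem := intermediate_value_Icc (show (-2:ℝ) ≤ -1 by norm_num) hcont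
    have : (0:ℝ) ∈ Set.Icc ((-2:ℝ) ^ 3 - (a : ℝ) * (-2) ^ 2 - ((a : ℝ) + 3) * (-2) - 1)
        ((-1:ℝ) ^ 3 - (a : ℝ) * (-1) ^ 2 - ((a : ℝ) + 3) * (-1) - 1) := by
      have : (0:ℝ) ≤ a := by positivity
      constructor <;> linarith
    obtain ⟨x, hx, h0⟩ := hmem this
    have h0' : x ^ 3 - (a : ℝ) * x ^ 2 - ((a : ℝ) + 3) * x - 1 = 0 := h0
    have hx1 : x ≠ -1 := by
      rintro rfl
      norm_num at h0'
      linarith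
    exact (hmin x h0').trans_lt (lt_of_le_of_ne hx.2 hx1)
  have hα0 : α ≠ 0 := by linarith
  have hα2 : 1 + α ≠ 0 := by linarith
  have hi1 : α⁻¹ < 0 := inv_lt_zero.2 (by linarith)
  have hi2 : -1 < α⁻¹ := by
    have : α * α⁻¹ = 1 := mul_inv_cancel₀ hα0
    nlinarith
  have hi3 : (1+α)⁻¹ < 0 := inv_lt_zero.2 (by linarith)
  obtain ⟨x, y, z, rfl⟩ := hcoord γ hγmem
  have hne : nf16 a x y z ≠ 0 := by
    intro h
    have := hnorm x y z
    rw [h, Int.cast_zero] at this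
    exact hγ0 (Algebra.norm_eq_zero_iff.1 this)
  refine core (a : ℤ) (by exact_mod_cast ha)
    (fun x y z => Q ((x : cubicField α) + y * c + z * c^2)) ?_ ?_ ?_ ?_ ?_
    α (-1 - α⁻¹) (-(1+α)⁻¹) ?_ ?_ ?_ hα1 (by linarith) (by linarith) (by linarith) x y z hne
  · intro x y z h
    left
    rw [hnorm]
    refine le_trans ?_ (le_abs_self _)
    exact_mod_cast h
  · intro n
    right
    exact ⟨n, 1, by simp⟩
  · intro x y z h
    refine (hQu (-1) nneg _).1 ?_
    convert h using 1
    push_cast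
    ring
  · intro x y z
    rw [← hQu uA nA (x + y * c + z * c^2), huA]
    apply iff_of_eq
    congr 1
    push_cast
    linear_combination -(z : cubicField α) * hc
  · intro x y z
    rw [← hQu uB nB (x + y * c + z * c^2), huB]
    apply iff_of_eq
    congr 1
    push_cast
    linear_combination -(z : cubicField α) * hc
  · push_cast
    field_simp
    linear_combination hα
  · push_cast
    field_simp
    linear_combination -hα
  · field_simp
    ring
end

section
/- Let a ≥ 1 be a natural number such that m = a²+3a+9 is squarefree and 2a+3 = b² for some integer b, let α be the smallest real root of f_a = x³ − a·x² − (a+3)·x − 1, and K = ℚ(α). Then α+2 is not a square in the ring of integers of K; more precisely, if α+2 = r²·ε with r ∈ ℤ and ε a unit of the ring of integers, then r = ±1. -/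
open Polynomial in
lemma aux_deg (a : ℕ) (α : ℝ) (hα : α ^ 3 - (a : ℝ) * α ^ 2 - ((a : ℝ) + 3) * α - 1 = 0) :
    (minpoly ℚ α).natDegree = 3 ∧ IsIntegral ℚ α := by
  set f : ℤ[X] := X ^ 3 + C (-(a:ℤ)) * X ^ 2 + C (-((a:ℤ)+3)) * X + C (-1) with hf
  have hnd : f.natDegree = 3 := by rw [hf]; compute_degree!
  have hmon : f.Monic := by rw [hf]; monicity!
  have hroot : aeval α f = 0 := by
    rw [hf]
    simp only [map_add, map_mul, map_pow, aeval_X, aeval_C]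
    simp
    linarith
  have hirr : Irreducible f := by
    rw [hmon.irreducible_iff_roots_eq_zero_of_degree_le_three (by omega) (by omega)]
    apply Multiset.eq_zero_of_forall_notMem
    intro x hx
    rw [mem_roots hmon.ne_zero, IsRoot.def, hf] at hx
    simp at hx
    have hu : x * (x ^ 2 - a * x - (a + 3)) = 1 := by linarith
    rcases Int.eq_one_or_neg_one_of_mul_eq_one hu with h | h
    · subst h; omega
    · subst h; omega
  have hint : IsIntegral ℤ α := ⟨f, hmon, by simpa [aeval_def] using hroot⟩
  have h1 : Irreducible (f.map (algebraMap ℤ ℚ)) :=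
    (hmon.irreducible_iff_irreducible_map_fraction_map).1 hirr
  have h2 := minpoly.eq_of_irreducible_of_monic h1 (x := α)
    (by rw [aeval_map_algebraMap]; exact hroot) (hmon.map _)
  refine ⟨?_, hint.tower_top⟩
  rw [← h2, hmon.natDegree_map, hnd]

open Polynomial in
lemma aux_indep (α : ℝ) (h : (minpoly ℚ α).natDegree = 3) (A B C' : ℤ)
    (h0 : (A:ℝ) * α ^ 2 + B * α + C' = 0) : A = 0 ∧ B = 0 ∧ C' = 0 := by
  set g : ℚ[X] := C (A:ℚ) * X ^ 2 + C (B:ℚ) * X + C (C':ℚ) with hg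
  have hd : g.natDegree ≤ 2 := by rw [hg]; compute_degree
  have hg0 : g = 0 := by
    by_contra hne
    have h5 := natDegree_le_natDegree (minpoly.degree_le_of_ne_zero ℚ α hne (by
      rw [hg]; simp only [map_add, map_mul, map_pow, aeval_X, aeval_C]; simpa using h0))
    omega
  have c2 : g.coeff 2 = A := by rw [hg]; simp only [coeff_add, coeff_C_mul, coeff_X_pow, coeff_X, coeff_C]; simp
  have c1 : g.coeff 1 = B := by rw [hg]; simp only [coeff_add, coeff_C_mul, coeff_X_pow, coeff_X, coeff_C]; simp
  have c0 : g.coeff 0 = C' := by rw [hg]; simp only [coeff_add, coeff_C_mul, coeff_X_pow, coeff_X, coeff_C]; simp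
  rw [hg0] at c2 c1 c0
  simp at c2 c1 c0
  exact ⟨by exact_mod_cast c2.symm, by exact_mod_cast c1.symm, by exact_mod_cast c0.symm⟩

open Polynomial in
lemma aux_cubic (α : ℝ) (h : (minpoly ℚ α).natDegree = 3) (hi : IsIntegral ℚ α)
    (β : integralClosure ℤ (cubicField α)) :
    ∃ p q s : ℤ, (((β : cubicField α) : ℝ)) ^ 3 + p * ((β : cubicField α) : ℝ) ^ 2
      + q * ((β : cubicField α) : ℝ) + s = 0 := by
  have hβ : IsIntegral ℤ (β : cubicField α) := β.2
  have hfr : Module.finrank ℚ (cubicField α) = 3 := by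
    rw [IntermediateField.adjoin.finrank hi, h]
  have : FiniteDimensional ℚ (cubicField α) := IntermediateField.adjoin.finiteDimensional hi
  set m := minpoly ℤ (β : cubicField α) with hm
  have hmon : m.Monic := minpoly.monic hβ
  have hle : m.natDegree ≤ 3 := by
    have := minpoly.natDegree_le (A := ℚ) (β : cubicField α)
    rw [minpoly.isIntegrallyClosed_eq_field_fractions' ℚ hβ, hmon.natDegree_map, hfr] at this
    exact this
  set g : ℤ[X] := X ^ (3 - m.natDegree) * m with hg
  have gmon : g.Monic := (monic_X_pow _).mul hmon
  have gd : g.natDegree = 3 := by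
    rw [hg, (monic_X_pow _).natDegree_mul hmon, natDegree_X_pow]; omega
  have g0 : aeval ((β : cubicField α)) g = 0 := by
    rw [hg, map_mul, minpoly.aeval, mul_zero]
  rw [aeval_eq_sum_range, gd] at g0
  have c3 : g.coeff 3 = 1 := by rw [← gd]; exact gmon
  simp [Finset.sum_range_succ, c3] at g0
  refine ⟨g.coeff 2, g.coeff 1, g.coeff 0, ?_⟩
  have := congrArg (fun x : cubicField α => (x : ℝ)) g0
  simp at this
  linarith

lemma aux_dioph (p q s a : ℤ) (ha : 1 ≤ a)
    (h1 : p ^ 2 - 2 * q = a + 6) (h2 : q ^ 2 - 2 * p * s = 3 * a + 9) (h3 : s ^ 2 = 2 * a + 3) :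
    a = 3 := by
  -- put u = 2p²-s²-9 = 4q, w = u+7
  have key : (4 * q + 4) ^ 2 - 16 * (s + p) ^ 2 = 16 := by
    linear_combination 16 * h2 - 16 * h1 - 16 * h3
  have key2 : (q + 1 - (s + p)) * (q + 1 + (s + p)) = 1 := by linarith
  have ht : s + p = 0 ∧ (q + 1 = 1 ∨ q + 1 = -1) := by
    rcases Int.eq_one_or_neg_one_of_mul_eq_one' key2 with h | h <;> omega
  obtain ⟨ht, hq⟩ := ht
  have hp : p = -s := by linarith
  subst hp
  have : (-s) ^ 2 = s ^ 2 := by ring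
  rcases hq with h | h <;> omega

/-- Let `a ≥ 1` with `m = a²+3a+9` squarefree and `2a+3 = b²` for some
integer `b`, let `α` be the smallest real root of `f_a = x³ − a·x² − (a+3)·x − 1`,
and `K = ℚ(α)`. Then `α+2` is not a square in the ring of integers of `K`; more
precisely, if `α+2 = r²·ε` with `r ∈ ℤ` and `ε` a unit of the ring of integers,
then `r = ±1`. -/
theorem stmt_18 (a : ℕ) (ha : 1 ≤ a)
    (hsq : Squarefree ((a : ℤ) ^ 2 + 3 * a + 9)) (b : ℤ) (hb : 2 * (a : ℤ) + 3 = b ^ 2)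
    (α : ℝ) (hα : α ^ 3 - (a : ℝ) * α ^ 2 - ((a : ℝ) + 3) * α - 1 = 0)
    (hmin : ∀ x : ℝ, x ^ 3 - (a : ℝ) * x ^ 2 - ((a : ℝ) + 3) * x - 1 = 0 → α ≤ x) :
    (¬ ∃ β : integralClosure ℤ (cubicField α),
        ((β : cubicField α)) ^ 2 = cubicGen α + 2) ∧
    (∀ (r : ℤ) (ε : (integralClosure ℤ (cubicField α))ˣ),
      cubicGen α + 2
          = (r : cubicField α) ^ 2 * ((ε : integralClosure ℤ (cubicField α)) : cubicField α) →
        r = 1 ∨ r = -1) := by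
  obtain ⟨hd, hi⟩ := aux_deg a α hα
  have hno9 : ¬ (9 : ℤ) ∣ (a : ℤ) ^ 2 + 3 * a + 9 := by
    intro h
    have := hsq 3 (by rw [show (3:ℤ) * 3 = 9 by norm_num]; exact h)
    rw [Int.isUnit_iff] at this
    omega
  -- a cubic relation for y = α+2
  have cmp : ∀ P Q S : ℤ, (α + 2) ^ 3 + P * (α + 2) ^ 2 + Q * (α + 2) + S = 0 →
      P = -(a + 6) ∧ Q = 3 * a + 9 ∧ S = -(2 * a + 3) := by
    intro P Q S h
    have := aux_indep α hd (P + a + 6) (4 * (P + a + 6) + (Q - (3 * a + 9)))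
      (4 * (P + a + 6) + 2 * (Q - (3 * a + 9)) + (S + (2 * a + 3))) (by
        push_cast
        linear_combination h - hα)
    omega
  have two : ((2 : cubicField α) : ℝ) = 2 := rfl
  constructor
  · rintro ⟨β, hβ⟩
    obtain ⟨p, q, s, h⟩ := aux_cubic α hd hi β
    have hβ' : ((β : cubicField α) : ℝ) ^ 2 = α + 2 := by
      have := congrArg (fun x : cubicField α => (x : ℝ)) hβ
      simpa [cubicGen, two] using this
    set x := ((β : cubicField α) : ℝ)
    obtain ⟨h1, h2, h3⟩ := cmp (2 * q - p ^ 2) (q ^ 2 - 2 * p * s) (-s ^ 2) (by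
      rw [← hβ']; push_cast
      linear_combination (x ^ 3 + q * x - p * x ^ 2 - s) * h)
    have h3' := aux_dioph p q s a (by omega) (by linarith) (by linarith) (by linarith)
    apply hno9
    rw [h3']; norm_num
  · intro r ε hε
    obtain ⟨p, q, s, h⟩ := aux_cubic α hd hi ε
    have hε' : α + 2 = (r:ℝ) ^ 2 * (((ε : integralClosure ℤ (cubicField α)) : cubicField α) : ℝ) := by
      have := congrArg (fun x : cubicField α => (x : ℝ)) hε
      simpa [cubicGen, two] using this
    set x := (((ε : integralClosure ℤ (cubicField α)) : cubicField α) : ℝ)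
    obtain ⟨h1, h2, h3⟩ := cmp (p * r ^ 2) (q * r ^ 4) (s * r ^ 6) (by
      rw [hε']; push_cast
      linear_combination (r:ℝ) ^ 6 * h)
    have d1 : r ^ 2 ∣ (a : ℤ) + 6 := ⟨-p, by linarith⟩
    have d2 : r ^ 2 ∣ 9 := by
      refine ⟨-2 * p + s * r ^ 4, ?_⟩
      linear_combination 2 * h1 - h3
    have hr : r ∣ 3 := by
      rw [← Int.pow_dvd_pow_iff two_ne_zero]; simpa using d2
    have hr' : r.natAbs ∣ 3 := by simpa using Int.natAbs_dvd_natAbs.2 hr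
    rcases (Nat.dvd_prime Nat.prime_three).1 hr' with h | h
    · omega
    · exfalso
      apply hno9
      have : r ^ 2 = 9 := by rw [← Int.natAbs_sq, h]; norm_num
      rw [this] at d1
      obtain ⟨k, hk⟩ := d1
      have : (a : ℤ) = 9 * k - 6 := by linarith
      rw [this]
      exact ⟨9 * k ^ 2 - 9 * k + 3, by ring⟩
end

section
/- Let a ≥ 1 be a natural number such that m = a²+3a+9 is squarefree with m > 13 and 6a+19 = b² for some integer b, let α be the smallest real root of f_a = x³ − a·x² − (a+3)·x − 1, and K = ℚ(α). Then α·(2α−1) is not a square in the ring of integers of K. -/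
open Polynomial in
lemma aux_monic (A : ℚ) : (X ^ 3 - C A * X ^ 2 - C (A+3) * X - 1 : ℚ[X]).Monic ∧
    (X ^ 3 - C A * X ^ 2 - C (A+3) * X - 1 : ℚ[X]).natDegree = 3 := by
  constructor
  · monicity!
  · compute_degree!

open Polynomial in
lemma aux_irr (a : ℕ) : Irreducible (X ^ 3 - C (a:ℚ) * X ^ 2 - C ((a:ℚ)+3) * X - 1 : ℚ[X]) := by
  obtain ⟨h1, h2⟩ := aux_monic (a:ℚ)
  rw [h1.irreducible_iff_roots_eq_zero_of_degree_le_three (by omega) (by omega)]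
  rw [Multiset.eq_zero_iff_forall_notMem]
  intro q hq
  rw [mem_roots h1.ne_zero, IsRoot.def] at hq
  simp only [eval_sub, eval_pow, eval_X, eval_mul, eval_C, eval_one] at hq
  have hint : IsIntegral ℤ q := by
    refine ⟨X ^ 3 - C (a:ℤ) * X ^ 2 - C ((a:ℤ)+3) * X - 1, by monicity!, ?_⟩
    simp [eval₂_sub, eval₂_mul]
    linarith
  obtain ⟨n, rfl⟩ := IsIntegrallyClosed.isIntegral_iff.mp hint
  simp only [eq_intCast] at hq
  have hz : n ^ 3 - (a:ℤ) * n ^ 2 - ((a:ℤ)+3) * n - 1 = 0 := by exact_mod_cast hq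
  have hd : n ∣ 1 := ⟨n^2 - a * n - (a+3), by linarith⟩
  rcases Int.isUnit_iff.mp (isUnit_of_dvd_one hd) with rfl | rfl <;> ring_nf at hz <;> omega

open Polynomial in
lemma aux_indep_s19 (a : ℕ) (α : ℝ)
    (hα : α ^ 3 - (a : ℝ) * α ^ 2 - ((a : ℝ) + 3) * α - 1 = 0) (u v w : ℚ)
    (h : (u:ℝ) + v * α + w * α ^ 2 = 0) : u = 0 ∧ v = 0 ∧ w = 0 := by
  obtain ⟨h1, h2⟩ := aux_monic (a:ℚ)
  have hmp := minpoly.eq_of_irreducible_of_monic (x := α) (aux_irr a)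
    (by simp; linarith) h1
  have hdvd : minpoly ℚ α ∣ (C u + C v * X + C w * X ^ 2 : ℚ[X]) := by
    apply minpoly.dvd
    simp; linarith
  rw [← hmp] at hdvd
  have h0 : (C u + C v * X + C w * X ^ 2 : ℚ[X]) = 0 := by
    apply eq_zero_of_dvd_of_natDegree_lt hdvd
    rw [h2]
    have : (C u + C v * X + C w * X ^ 2 : ℚ[X]).natDegree ≤ 2 := by compute_degree
    omega
  have c0 := congrArg (fun p => coeff p 0) h0
  have c1 := congrArg (fun p => coeff p 1) h0
  have c2 := congrArg (fun p => coeff p 2) h0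
  simp [coeff_X, coeff_C, coeff_X_pow] at c0 c1 c2
  exact ⟨c0, c1, c2⟩

open Polynomial in
lemma aux_rep (a : ℕ) (α : ℝ)
    (hα : α ^ 3 - (a : ℝ) * α ^ 2 - ((a : ℝ) + 3) * α - 1 = 0) (β : cubicField α) :
    ∃ x y z : ℚ, (β : ℝ) = x + y * α + z * α ^ 2 := by
  obtain ⟨h1, h2⟩ := aux_monic (a:ℚ)
  have hev : aeval α (X ^ 3 - C (a:ℚ) * X ^ 2 - C ((a:ℚ)+3) * X - 1 : ℚ[X]) = 0 := by
    simp; linarith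
  have hal : IsAlgebraic ℚ α := ⟨_, h1.ne_zero, hev⟩
  have hm : (β : ℝ) ∈ (IntermediateField.adjoin ℚ {α}).toSubalgebra := β.2
  rw [IntermediateField.adjoin_simple_toSubalgebra_of_isAlgebraic hal,
    Algebra.adjoin_singleton_eq_range_aeval] at hm
  obtain ⟨p, hp⟩ := hm
  set F := (X ^ 3 - C (a:ℚ) * X ^ 2 - C ((a:ℚ)+3) * X - 1 : ℚ[X]) with hF
  have hr : aeval α (p %ₘ F) = (β:ℝ) := by
    rw [← hp]
    conv_rhs => rw [← modByMonic_add_div p F]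
    simp [hev]
  have hd : (p %ₘ F).natDegree < 3 := by
    rw [← h2]; exact natDegree_modByMonic_lt _ h1 (by intro h; rw [h] at h2; simp at h2)
  refine ⟨(p %ₘ F).coeff 0, (p %ₘ F).coeff 1, (p %ₘ F).coeff 2, ?_⟩
  rw [← hr, aeval_eq_sum_range' hd]
  simp [Finset.sum_range_succ, Algebra.smul_def]

lemma aux_int (q : ℚ) (h : IsIntegral ℤ (q : ℝ)) : ∃ n : ℤ, q = n := by
  have : IsIntegral ℤ q := by
    rw [← isIntegral_algebraMap_iff (A := ℚ) (B := ℝ) (algebraMap ℚ ℝ).injective]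
    exact h
  obtain ⟨n, hn⟩ := IsIntegrallyClosed.isIntegral_iff.mp this
  exact ⟨n, by simpa using hn.symm⟩

/-- Arithmetic core. -/
lemma aux_arith (a m X Y Z : ℤ) (hm : m = a ^ 2 + 3 * a + 9) (hsq : Squarefree m)
    (e0 : X^2 + 2*Y*Z + a*Z^2 = 0)
    (e1 : 2*X*Y + 2*Y*Z*(a+3) + Z^2*(a^2+3*a+1) = -m^2)
    (e2 : Y^2 + 2*X*Z + 2*Y*Z*a + Z^2*(a^2+a+3) = 2*m^2) : m ∣ Z := by
  have h3 : ¬ (3:ℤ) ∣ m := by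
    intro h
    have h3a : (3:ℤ) ∣ a := by
      rw [hm] at h
      have : (3:ℤ) ∣ a^2 := by
        have := dvd_sub h (⟨a+3, by ring⟩ : (3:ℤ) ∣ 3*a+9)
        simpa [add_assoc] using this
      exact Int.prime_three.dvd_of_dvd_pow this
    obtain ⟨k, rfl⟩ := h3a
    have : (3:ℤ)*3 ∣ m := ⟨k^2+k+1, by rw [hm]; ring⟩
    have := hsq 3 this
    rw [Int.isUnit_iff] at this
    omega
  have hc : IsCoprime m (27:ℤ) := by
    have : IsCoprime (3:ℤ) m := (Int.prime_three.coprime_iff_not_dvd).mpr h3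
    have := (this.pow_left (m := 3)).symm
    norm_num at this
    exact this
  set R := 9*X + 3*a*Y + a^2*Z with hR
  set S := 3*Y + 2*a*Z with hS
  have E2 : S^2 + 2*R*Z + 3*m*Z^2 = 9 * (2*m^2) := by
    rw [← e2, hR, hS, hm]; ring
  have E1 : 2*R*S + 6*m*S*Z + (2*a+3)*m*Z^2 = 27 * (-m^2) + 18*a*(2*m^2) := by
    rw [← e2, ← e1, hR, hS, hm]; ring
  have E0 : R^2 + 2*S*Z*((2*a+3)*m) = 27*a*(-m^2) + 9*a^2*(2*m^2) := by
    have : R^2 + 2*S*Z*((2*a+3)*m) = 81*(X^2 + 2*Y*Z + a*Z^2) + 27*a*(-m^2) + 9*a^2*(2*m^2) := by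
      rw [← e2, ← e1, hR, hS, hm]; ring
    rw [this, e0]; ring
  have dR : m ∣ R := by
    rw [← hsq.dvd_pow_iff_dvd (n := 2) (by norm_num)]
    exact ⟨27*a*(-m) + 9*a^2*(2*m) - 2*S*Z*(2*a+3), by linear_combination E0⟩
  obtain ⟨R', hR'⟩ := dR
  have dS : m ∣ S := by
    rw [← hsq.dvd_pow_iff_dvd (n := 2) (by norm_num)]
    exact ⟨18*m - 2*R'*Z - 3*Z^2, by rw [hR'] at E2; linear_combination E2⟩
  obtain ⟨S', hS'⟩ := dS
  have hm0 : m ≠ 0 := hsq.ne_zero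
  have k : (2*a+3)*Z^2 = m * (-27 + 36*a - 2*R'*S' - 6*S'*Z) := by
    apply mul_left_cancel₀ hm0
    rw [hR', hS'] at E1
    linear_combination E1
  rw [← hsq.dvd_pow_iff_dvd (n := 2) (by norm_num)]
  apply hc.dvd_of_dvd_mul_left
  refine ⟨4 * Z^2 - (2*a+3) * (-27 + 36*a - 2*R'*S' - 6*S'*Z), ?_⟩
  have : (4 * m - (2*a+3)^2) = 27 := by rw [hm]; ring
  linear_combination (-(Z^2)) * this - (2*a+3) * k

set_option maxHeartbeats 1000000 in
theorem stmt_19 (a : ℕ) (ha : 1 ≤ a)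
    (hsq : Squarefree ((a : ℤ) ^ 2 + 3 * a + 9))
    (hm : 13 < (a : ℤ) ^ 2 + 3 * a + 9)
    (b : ℤ) (hb : 6 * (a : ℤ) + 19 = b ^ 2)
    (α : ℝ) (hα : α ^ 3 - (a : ℝ) * α ^ 2 - ((a : ℝ) + 3) * α - 1 = 0)
    (hmin : ∀ x : ℝ, x ^ 3 - (a : ℝ) * x ^ 2 - ((a : ℝ) + 3) * x - 1 = 0 → α ≤ x) :
    ¬ ∃ β : integralClosure ℤ (cubicField α),
        ((β : cubicField α)) ^ 2 = cubicGen α * (2 * cubicGen α - 1) := by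
  rintro ⟨β, hβ⟩
  have ha5 : 5 ≤ a := by
    by_contra hlt
    have h4 : a = 1 ∨ a = 2 ∨ a = 3 ∨ a = 4 := by omega
    have hb1 : b ≤ 7 := by nlinarith
    have hb2 : -7 ≤ b := by nlinarith
    rcases h4 with rfl | rfl | rfl | rfl
    · norm_num at hm
    all_goals
      interval_cases b <;> norm_num at hb
  have hβ' : ((β : cubicField α) : ℝ) ^ 2 = α * (2 * α - 1) := by
    have := congrArg (fun t : cubicField α => (t : ℝ)) hβ
    exact this
  obtain ⟨x, y, z, hxyz⟩ := aux_rep a α hα β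
  rw [hxyz] at hβ'
  obtain ⟨e0, e1, e2⟩ := aux_indep_s19 a α hα (x^2 + 2*y*z + a*z^2)
    (2*x*y + 2*y*z*(a+3) + z^2*(a^2+3*a+1) + 1)
    (y^2 + 2*x*z + 2*y*z*a + z^2*(a^2+a+3) - 2) (by
      push_cast
      linear_combination hβ' - (2*y*z + z^2*α + a * z^2) * hα)
  have f0 : (x:ℝ)^2 + 2*y*z + a*z^2 = 0 := by exact_mod_cast e0
  have f1 : 2*(x:ℝ)*y + 2*y*z*(a+3) + z^2*(a^2+3*a+1) + 1 = 0 := by exact_mod_cast e1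
  have f2 : (y:ℝ)^2 + 2*x*z + 2*y*z*a + z^2*(a^2+a+3) - 2 = 0 := by exact_mod_cast e2
  have key : ∀ r : ℝ, r ^ 3 - (a : ℝ) * r ^ 2 - ((a : ℝ) + 3) * r - 1 = 0 →
      ((x:ℝ) + y * r + z * r^2)^2 = 2 * r^2 - r := by
    intro r hr
    linear_combination f0 + r * f1 + r^2 * f2 + (2*y*z + z^2*r + a * z^2) * hr
  have kint : ∀ r : ℝ, r ^ 3 - (a : ℝ) * r ^ 2 - ((a : ℝ) + 3) * r - 1 = 0 → IsIntegral ℤ r := by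
    intro r hr
    open Polynomial in
    refine ⟨X ^ 3 - C (a:ℤ) * X ^ 2 - C ((a:ℤ)+3) * X - 1, by monicity!, ?_⟩
    simp [Polynomial.eval₂_sub, Polynomial.eval₂_mul]
    linarith
  have kint2 : ∀ r : ℝ, r ^ 3 - (a : ℝ) * r ^ 2 - ((a : ℝ) + 3) * r - 1 = 0 →
      IsIntegral ℤ ((x:ℝ) + y * r + z * r^2) := by
    intro r hr
    apply IsIntegral.of_pow (n := 2) (by norm_num)
    rw [key r hr]
    have h := kint r hr
    have : 2 * r^2 - r = r^2 + r^2 - r := by ring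
    rw [this]
    exact ((h.pow 2).add (h.pow 2)).sub h
  have haR : (5:ℝ) ≤ a := by exact_mod_cast ha5
  obtain ⟨ρ, ⟨hρ1, hρ2⟩, hρ⟩ : ∃ ρ ∈ Set.Icc ((a:ℝ)+1) (a+2),
      ρ ^ 3 - (a : ℝ) * ρ ^ 2 - ((a : ℝ) + 3) * ρ - 1 = 0 := by
    have := intermediate_value_Icc (f := fun ρ : ℝ => ρ ^ 3 - (a : ℝ) * ρ ^ 2 - ((a : ℝ) + 3) * ρ - 1)
      (show (a:ℝ)+1 ≤ a+2 by linarith) (by fun_prop)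
    exact this ⟨by ring_nf; nlinarith, by ring_nf; nlinarith⟩
  have hρ0 : 0 < ρ := by linarith
  have hρ10 : 0 < 1 + ρ := by linarith
  obtain ⟨i, hi⟩ : ∃ i, i = ρ⁻¹ := ⟨_, rfl⟩
  obtain ⟨j, hj⟩ : ∃ j, j = (1+ρ)⁻¹ := ⟨_, rfl⟩
  have hi1 : i * ρ = 1 := by rw [hi]; field_simp
  have hj1 : j * (1 + ρ) = 1 := by rw [hj]; field_simp
  have hi0 : 0 < i := by rw [hi]; positivity
  have hj0 : 0 < j := by rw [hj]; positivity
  have hi6 : i ≤ 1/6 := by nlinarith only [hi1, hi0, hρ1, haR]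
  have hj6 : j ≤ 1/6 := by nlinarith only [hj1, hj0, hρ1, haR]
  have haρ : (a:ℝ) = (ρ^3 - 3*ρ - 1) * i * j := by
    rw [hi, hj]; field_simp; linarith
  have g2 : (-1-i) ^ 3 - (a : ℝ) * (-1-i) ^ 2 - ((a : ℝ) + 3) * (-1-i) - 1 = 0 := by
    rw [haρ, hi, hj]; field_simp; ring
  have g3 : (-j) ^ 3 - (a : ℝ) * (-j) ^ 2 - ((a : ℝ) + 3) * (-j) - 1 = 0 := by
    rw [haρ, hi, hj]; field_simp; ring
  have V : (ρ - (-1-i)) * ((-1-i) - (-j)) * (ρ - (-j)) = - ((a:ℝ)^2 + 3*a + 9) := by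
    rw [haρ, hi, hj]; field_simp; ring
  have k1 := key _ hρ
  have k2 := key _ g2
  have k3 := key _ g3
  have I1 := kint _ hρ
  have I2 := kint _ g2
  have I3 := kint _ g3
  have J1 := kint2 _ hρ
  have J2 := kint2 _ g2
  have J3 := kint2 _ g3
  generalize hr2 : -1 - i = r2 at *
  generalize hr3 : -j = r3 at *
  obtain ⟨B1, hB1⟩ : ∃ B, B = (x:ℝ) + y * ρ + z * ρ^2 := ⟨_, rfl⟩
  obtain ⟨B2, hB2⟩ : ∃ B, B = (x:ℝ) + y * r2 + z * r2^2 := ⟨_, rfl⟩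
  obtain ⟨B3, hB3⟩ : ∃ B, B = (x:ℝ) + y * r3 + z * r3^2 := ⟨_, rfl⟩
  rw [← hB1] at k1 J1
  rw [← hB2] at k2 J2
  rw [← hB3] at k3 J3
  have Lz : (((a^2+3*a+9) * z : ℚ) : ℝ) = -(B1 * (r2 - r3) - B2 * (ρ - r3) + B3 * (ρ - r2)) := by
    push_cast
    rw [hB1, hB2, hB3]
    linear_combination z * V
  have Ly : (((a^2+3*a+9) * y : ℚ) : ℝ) =
      B1 * (r2^2 - r3^2) - B2 * (ρ^2 - r3^2) + B3 * (ρ^2 - r2^2) := by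
    push_cast
    rw [hB1, hB2, hB3]
    linear_combination y * V
  have Lx : (((a^2+3*a+9) * x : ℚ) : ℝ) =
      -(B1 * (r2*r3*(r2 - r3)) - B2 * (ρ*r3*(ρ - r3)) + B3 * (ρ*r2*(ρ - r2))) := by
    push_cast
    rw [hB1, hB2, hB3]
    linear_combination x * V
  obtain ⟨Z, hZ⟩ := aux_int ((a^2+3*a+9) * z) (by
    rw [Lz]
    exact (((J1.mul (I2.sub I3)).sub (J2.mul (I1.sub I3))).add (J3.mul (I1.sub I2))).neg)
  obtain ⟨Y, hY⟩ := aux_int ((a^2+3*a+9) * y) (by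
    rw [Ly]
    exact (((J1.mul ((I2.pow 2).sub (I3.pow 2))).sub (J2.mul ((I1.pow 2).sub (I3.pow 2)))).add
      (J3.mul ((I1.pow 2).sub (I2.pow 2)))))
  obtain ⟨W, hW⟩ := aux_int ((a^2+3*a+9) * x) (by
    rw [Lx]
    exact (((J1.mul ((I2.mul I3).mul (I2.sub I3))).sub (J2.mul ((I1.mul I3).mul (I1.sub I3)))).add
      (J3.mul ((I1.mul I2).mul (I1.sub I2)))).neg)
  have hdvd : ((a : ℤ) ^ 2 + 3 * a + 9) ∣ Z := by
    apply aux_arith (a:ℤ) _ W Y Z rfl hsq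
    · have : (W:ℚ)^2 + 2*Y*Z + a*Z^2 = 0 := by
        rw [← hW, ← hY, ← hZ]; linear_combination ((a:ℚ)^2+3*a+9)^2 * e0
      exact_mod_cast this
    · have : 2*(W:ℚ)*Y + 2*Y*Z*(a+3) + Z^2*(a^2+3*a+1) = -((a:ℚ)^2+3*a+9)^2 := by
        rw [← hW, ← hY, ← hZ]; linear_combination ((a:ℚ)^2+3*a+9)^2 * e1
      exact_mod_cast this
    · have : (Y:ℚ)^2 + 2*W*Z + 2*Y*Z*a + Z^2*(a^2+a+3) = 2*((a:ℚ)^2+3*a+9)^2 := by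
        rw [← hW, ← hY, ← hZ]; linear_combination ((a:ℚ)^2+3*a+9)^2 * e2
      exact_mod_cast this
  have b1 : |B1| ≤ 3/2 * ρ := by
    apply abs_le_of_sq_le_sq _ (by positivity)
    rw [k1]; nlinarith only [sq_nonneg ρ, hρ0]
  have b2 : |B2| ≤ 2 := by
    apply abs_le_of_sq_le_sq _ (by norm_num)
    rw [k2, ← hr2]; nlinarith only [hi0, hi6, mul_nonneg hi0.le (sub_nonneg.mpr hi6)]
  have b3 : |B3| ≤ 1 := by
    apply abs_le_of_sq_le_sq _ (by norm_num)
    rw [k3, ← hr3]; nlinarith only [hj0, hj6, mul_nonneg hj0.le (sub_nonneg.mpr hj6)]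
  have hij : j ≤ i := by
    rw [hi, hj]; exact inv_anti₀ hρ0 (by linarith)
  have d1 : |r2 - r3| ≤ 1 + i := by
    rw [abs_le, ← hr2, ← hr3]; constructor <;> linarith
  have d2 : |ρ - r3| ≤ ρ + 1 := by
    rw [abs_le, ← hr3]; constructor <;> linarith
  have d3 : |ρ - r2| ≤ ρ + 2 := by
    rw [abs_le, ← hr2]; constructor <;> linarith
  have hZR : (Z:ℝ) = -(B1 * (r2 - r3) - B2 * (ρ - r3) + B3 * (ρ - r2)) := by
    rw [← Lz, hZ]; simp
  have bound : |(Z:ℝ)| < (a:ℝ)^2 + 3*a + 9 := by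
    have t1 : |B1 * (r2 - r3)| ≤ 3/2 * ρ * (1+i) := by
      rw [abs_mul]; exact mul_le_mul b1 d1 (abs_nonneg _) (by positivity)
    have t2 : |B2 * (ρ - r3)| ≤ 2 * (ρ+1) := by
      rw [abs_mul]; exact mul_le_mul b2 d2 (abs_nonneg _) (by positivity)
    have t3 : |B3 * (ρ - r2)| ≤ 1 * (ρ+2) := by
      rw [abs_mul]; exact mul_le_mul b3 d3 (abs_nonneg _) (by positivity)
    have t1' : 3/2 * ρ * (1+i) = 3/2 * ρ + 3/2 := by linear_combination 3/2 * hi1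
    rw [t1'] at t1
    rw [abs_le] at t1 t2 t3
    rw [hZR, abs_lt]
    constructor <;> nlinarith only [t1.1, t1.2, t2.1, t2.2, t3.1, t3.2, hρ2, haR]
  have hZ0 : Z = 0 := by
    apply Int.eq_zero_of_abs_lt_dvd hdvd
    exact_mod_cast bound
  have hz0 : z = 0 := by
    rw [hZ0] at hZ
    have : ((a:ℚ)^2+3*a+9) ≠ 0 := by positivity
    simpa [this] using hZ
  rw [hz0] at e2
  have y2 : (y:ℝ)^2 = 2 := by
    have : y^2 = 2 := by linarith
    exact_mod_cast this
  have : |(y:ℝ)| = √2 := by rw [← y2, Real.sqrt_sq_eq_abs]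
  exact irrational_sqrt_two ⟨|y|, by rw [← this]; simp⟩
end
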